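/- Let H be a bipartite graph and G = H_T obtained by attaching unions of complete graphs at vertices in a subset T ⊆ V(H). Then reg(S/I(G)^{(r)}) ≤ 2r + cochord(G) − 2 for all r ≥ 1. -/

import Mathlib

open MvPolynomial

noncomputable section

namespace EdgeIdealReg

open scoped Classical

/-- The edge ideal of a simple graph, in the polynomial ring with variables the vertices. -/
def edgeIdeal (K : Type) [Field K] {V : Type} (G : SimpleGraph V) :
    Ideal (MvPolynomial V K) :=
  Ideal.span { p | ∃ u v : V, G.Adj u v ∧ p = X u * X v }

/-- The edge ideal of the induced subgraph on a set `s` of vertices, viewed inside the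
polynomial ring of the ambient graph (extra variables do not change the regularity). -/
def edgeIdealOn (K : Type) [Field K] {V : Type} (G : SimpleGraph V) (s : Set V) :
    Ideal (MvPolynomial V K) :=
  Ideal.span { p | ∃ u v : V, G.Adj u v ∧ u ∈ s ∧ v ∈ s ∧ p = X u * X v }

/-- The `r`-th symbolic power of an ideal: the intersection over all minimal primes `p` of `I`
of the contraction of `I^r` localized at `p`; concretely,
`f ∈ I^{(r)}` iff for every minimal prime `p` of `I` there is `s ∉ p` with `s * f ∈ I ^ r`. -/
def symbolicPower {R : Type} [CommRing R] (I : Ideal R) (r : ℕ) : Ideal R where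
  carrier := { f | ∀ p ∈ I.minimalPrimes, ∃ s, s ∉ p ∧ s * f ∈ I ^ r }
  zero_mem' := by
    intro p hp
    exact ⟨1, (Ideal.ne_top_iff_one p).mp hp.1.1.ne_top, by simp⟩
  add_mem' := by
    intro a b ha hb p hp
    obtain ⟨s, hs, hsa⟩ := ha p hp
    obtain ⟨t, ht, htb⟩ := hb p hp
    refine ⟨s * t, fun h => ?_, ?_⟩
    · rcases hp.1.1.mem_or_mem h with h' | h'
      · exact hs h'
      · exact ht h'
    · have : s * t * (a + b) = t * (s * a) + s * (t * b) := by ring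
      rw [this]
      exact Ideal.add_mem _ (Ideal.mul_mem_left _ _ hsa) (Ideal.mul_mem_left _ _ htb)
  smul_mem' := by
    intro c f hf p hp
    obtain ⟨s, hs, hsf⟩ := hf p hp
    refine ⟨s, hs, ?_⟩
    have : s * (c • f) = c * (s * f) := by
      simp only [smul_eq_mul]; ring
    rw [this]
    exact Ideal.mul_mem_left _ _ hsf

/-- Symbolic power with an integer exponent, with the convention `I^{(k)} = S` for `k ≤ 0`. -/
def symbolicPowerZ {R : Type} [CommRing R] (I : Ideal R) (k : ℤ) : Ideal R :=
  if k ≤ 0 then ⊤ else symbolicPower I k.toNat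

/-- A graded free resolution of `S/I` over the polynomial ring `S = K[x_v]`:
`⋯ → F_{i+1} → F_i → ⋯ → F_0 = S → S/I → 0`, where `F_i` is a graded free module with
basis elements of degrees `deg i k`, the differentials are given by matrices of homogeneous
polynomials of the appropriate degrees, the image of `F_1 → F_0 = S` is `I`, and the
complex is exact in positive homological degrees. -/
structure GradedFreeResolution {K : Type} [Field K] {σ : Type}
    (I : Ideal (MvPolynomial σ K)) where
  rank : ℕ → ℕ
  deg : (i : ℕ) → Fin (rank i) → ℕ
  rank_zero : rank 0 = 1
  deg_zero : ∀ k, deg 0 k = 0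
  mat : (i : ℕ) → Matrix (Fin (rank i)) (Fin (rank (i + 1))) (MvPolynomial σ K)
  homog : ∀ i k j, mat i k j = 0 ∨
    ∃ e, deg (i + 1) j = deg i k + e ∧ (mat i k j).IsHomogeneous e
  range_zero : ∀ f : MvPolynomial σ K,
    f ∈ I ↔ (fun _ => f) ∈ LinearMap.range (Matrix.mulVecLin (mat 0))
  isExact : ∀ i, LinearMap.ker (Matrix.mulVecLin (mat i)) =
    LinearMap.range (Matrix.mulVecLin (mat (i + 1)))

/-- The Castelnuovo–Mumford regularity of the quotient `S/I` for a homogeneous ideal `I` of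
the polynomial ring: the least `d` such that some graded free resolution of `S/I` has all its
`i`-th syzygies generated in degrees `≤ d + i` (the minimal free resolution realizes the
infimum).  By convention `reg (S/S) = ⊥ = -∞`. -/

def regQuot {K : Type} [Field K] {σ : Type} (I : Ideal (MvPolynomial σ K)) : WithBot ℤ :=
  if I = ⊤ then ⊥
  else ((sInf { d : ℤ | ∃ F : GradedFreeResolution I,
      ∀ i (k : Fin (F.rank i)), (F.deg i k : ℤ) ≤ d + i } : ℤ) : WithBot ℤ)

/-- A set of edges of `G` that forms a matching: pairwise disjoint edges. -/
def IsMatchingSet {V : Type} (G : SimpleGraph V) (M : Finset (Sym2 V)) : Prop :=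
  (M : Set (Sym2 V)) ⊆ G.edgeSet ∧
    (M : Set (Sym2 V)).Pairwise fun e f => ∀ v, v ∈ e → v ∉ f

/-- An induced matching: a matching such that no two of its edges are joined by an edge
of `G`, i.e. it is the edge set of an induced subgraph. -/
def IsInducedMatchingSet {V : Type} (G : SimpleGraph V) (M : Finset (Sym2 V)) : Prop :=
  IsMatchingSet G M ∧
    (M : Set (Sym2 V)).Pairwise fun e f => ∀ u v, u ∈ e → v ∈ f → ¬G.Adj u v

/-- The matching number `mat(G)`. -/
def matchingNumber {V : Type} (G : SimpleGraph V) : ℕ :=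
  sSup { n | ∃ M, IsMatchingSet G M ∧ M.card = n }

/-- The induced matching number `ν(G)`. -/
def inducedMatchingNumber {V : Type} (G : SimpleGraph V) : ℕ :=
  sSup { n | ∃ M, IsInducedMatchingSet G M ∧ M.card = n }

/-- `G` has an induced cycle of length `n`. -/
def HasInducedCycle {V : Type} (G : SimpleGraph V) (n : ℕ) : Prop :=
  ∃ f : ZMod n → V, Function.Injective f ∧
    ∀ i j : ZMod n, G.Adj (f i) (f j) ↔ (j = i + 1 ∨ i = j + 1)

/-- A graph is chordal if every induced cycle has length `3`. -/
def Chordal {V : Type} (G : SimpleGraph V) : Prop :=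
  ∀ n, 4 ≤ n → ¬HasInducedCycle G n

/-- A graph is weakly chordal if every induced cycle in `G` and in `Gᶜ` has length at most 4. -/
def WeaklyChordal {V : Type} (G : SimpleGraph V) : Prop :=
  (∀ n, 5 ≤ n → ¬HasInducedCycle G n) ∧ ∀ n, 5 ≤ n → ¬HasInducedCycle Gᶜ n

/-- The co-chordal cover number `cochord(G)`: the least `n` such that `n` co-chordal
subgraphs of `G` cover all the edges of `G`. -/
def cochordNumber {V : Type} (G : SimpleGraph V) : ℕ :=
  sInf { n | ∃ H : Fin n → SimpleGraph V,
    (∀ i, H i ≤ G ∧ Chordal (H i)ᶜ) ∧ ∀ e ∈ G.edgeSet, ∃ i, e ∈ (H i).edgeSet }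

/-- A graph is unicyclic if it contains exactly one cycle. -/
def Unicyclic {V : Type} (G : SimpleGraph V) : Prop :=
  ∃ (v : V) (c : G.Walk v v), c.IsCycle ∧
    ∀ (w : V) (c' : G.Walk w w), c'.IsCycle → { e | e ∈ c'.edges } = { e | e ∈ c.edges }

/-- Data exhibiting `G` as the graph `H_T` obtained from the induced subgraph on `Hset`
by attaching, at each vertex of `T ⊆ Hset`, a union of complete graphs having that vertex as
their only common vertex: a family of cliques `C i` of `G`, each meeting `Hset` exactly in
its attachment vertex `a i ∈ T`, two distinct cliques meeting in at most the common
attachment vertex, together covering all vertices outside `Hset`, and all edges of `G`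
lying either inside `Hset` or inside one of the cliques. -/
structure CliqueAttachment {V : Type} (G : SimpleGraph V) (Hset T : Set V) where
  ι : Type
  C : ι → Finset V
  a : ι → V
  a_mem_T : ∀ i, a i ∈ T
  T_sub : T ⊆ Hset
  inter_H : ∀ i, (C i : Set V) ∩ Hset = {a i}
  a_mem_C : ∀ i, a i ∈ C i
  clique : ∀ i, G.IsClique (C i)
  pairwise_inter : ∀ i j, i ≠ j → (C i : Set V) ∩ (C j : Set V) ⊆ ({a i} : Set V)
  cover : Hset ∪ (⋃ i, (C i : Set V)) = Set.univ
  edges_sub : ∀ u v, G.Adj u v → (u ∈ Hset ∧ v ∈ Hset) ∨ ∃ i, u ∈ C i ∧ v ∈ C i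

end EdgeIdealReg

namespace RegAux
open EdgeIdealReg

/-! ## Part 1: resolutions -/

/-- `s` is zero or homogeneous of degree `n - a`. -/
def H1 {σ K : Type} [Field K] (a n : ℕ) (s : MvPolynomial σ K) : Prop :=
  s = 0 ∨ ∃ e, n = a + e ∧ s.IsHomogeneous e

/-- Homogeneous element of degree `n` of the graded free module with basis degrees `dg`. -/
def Hom {σ K : Type} [Field K] {ι : Type} (dg : ι → ℕ) (n : ℕ)
    (f : ι → MvPolynomial σ K) : Prop := ∀ i, H1 (dg i) n (f i)

section basic
variable {σ K : Type} [Field K]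

theorem H1.zero (a n : ℕ) : H1 a n (0 : MvPolynomial σ K) := Or.inl rfl

theorem H1.add {a n : ℕ} {s t : MvPolynomial σ K} (hs : H1 a n s) (ht : H1 a n t) :
    H1 a n (s + t) := by
  rcases hs with rfl | ⟨e, he, hs⟩
  · simpa using ht
  rcases ht with rfl | ⟨e', he', ht⟩
  · exact Or.inr ⟨e, he, by simpa using hs⟩
  · have : e = e' := by omega
    subst this
    exact Or.inr ⟨e, he, hs.add ht⟩

theorem H1.neg {a n : ℕ} {s : MvPolynomial σ K} (hs : H1 a n s) : H1 a n (-s) := by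
  rcases hs with rfl | ⟨e, he, hs⟩
  · exact Or.inl (by simp)
  · exact Or.inr ⟨e, he, by simpa using hs.neg⟩

theorem H1.sub {a n : ℕ} {s t : MvPolynomial σ K} (hs : H1 a n s) (ht : H1 a n t) :
    H1 a n (s - t) := by
  rw [sub_eq_add_neg]; exact hs.add ht.neg

theorem H1.mul {a b n : ℕ} {s t : MvPolynomial σ K} (hs : H1 a b s) (ht : H1 b n t) :
    H1 a n (t * s) := by
  rcases hs with rfl | ⟨e, he, hs⟩
  · exact Or.inl (by simp)
  rcases ht with rfl | ⟨e', he', ht⟩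
  · exact Or.inl (by simp)
  · exact Or.inr ⟨e' + e, by omega, ht.mul hs⟩

theorem H1.sum {ι : Type} (u : Finset ι) {a n : ℕ} {s : ι → MvPolynomial σ K}
    (hs : ∀ i ∈ u, H1 a n (s i)) : H1 a n (∑ i ∈ u, s i) := by
  classical
  induction u using Finset.induction_on with
  | empty => exact Or.inl (by simp)
  | insert i u hi ih =>
    rw [Finset.sum_insert hi]
    exact (hs i (by simp)).add (ih fun j hj => hs j (by simp [hj]))

theorem H1.shift {a n δ : ℕ} {s : MvPolynomial σ K} : H1 (a + δ) (n + δ) s ↔ H1 a n s := by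
  unfold H1
  constructor
  · rintro (h | ⟨e, he, h⟩)
    · exact Or.inl h
    · exact Or.inr ⟨e, by omega, h⟩
  · rintro (h | ⟨e, he, h⟩)
    · exact Or.inl h
    · exact Or.inr ⟨e, by omega, h⟩

theorem Hom.zero {ι : Type} (dg : ι → ℕ) (n : ℕ) : Hom dg n (0 : ι → MvPolynomial σ K) :=
  fun _ => H1.zero _ _

theorem Hom.add {ι : Type} {dg : ι → ℕ} {n : ℕ} {f g : ι → MvPolynomial σ K}
    (hf : Hom dg n f) (hg : Hom dg n g) : Hom dg n (f + g) := fun i => (hf i).add (hg i)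
theorem Hom.neg {ι : Type} {dg : ι → ℕ} {n : ℕ} {f : ι → MvPolynomial σ K}
    (hf : Hom dg n f) : Hom dg n (-f) := fun i => (hf i).neg
theorem Hom.sub {ι : Type} {dg : ι → ℕ} {n : ℕ} {f g : ι → MvPolynomial σ K}
    (hf : Hom dg n f) (hg : Hom dg n g) : Hom dg n (f - g) := fun i => (hf i).sub (hg i)

/-- Linear combination. -/
abbrev lc {ι κ : Type} [Fintype κ] (g : κ → ι → MvPolynomial σ K) :
    (κ → MvPolynomial σ K) →ₗ[MvPolynomial σ K] (ι → MvPolynomial σ K) :=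
  Fintype.linearCombination (MvPolynomial σ K) g

theorem lc_apply {ι κ : Type} [Fintype κ] (g : κ → ι → MvPolynomial σ K)
    (c : κ → MvPolynomial σ K) (i : ι) : lc g c i = ∑ j, c j * g j i := by
  simp [lc, Fintype.linearCombination_apply]

theorem Hom.lc {ι κ : Type} [Fintype κ] {g : κ → ι → MvPolynomial σ K} {dg : ι → ℕ}
    {dg' : κ → ℕ} (hg : ∀ j, Hom dg (dg' j) (g j)) {n : ℕ} {c : κ → MvPolynomial σ K}
    (hc : Hom dg' n c) : Hom dg n (lc g c) := by
  intro i
  rw [lc_apply]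
  exact H1.sum _ fun j _ => (hg j i).mul (hc j)

theorem lc_mem {ι κ : Type} [Fintype κ] {g : κ → ι → MvPolynomial σ K}
    {N : Submodule (MvPolynomial σ K) (ι → MvPolynomial σ K)}
    (hg : ∀ j, g j ∈ N) (c : κ → MvPolynomial σ K) : lc g c ∈ N := by
  rw [lc, Fintype.linearCombination_apply]
  exact Submodule.sum_mem _ fun j _ => Submodule.smul_mem _ _ (hg j)

theorem lc_sum {ι κ κ' : Type} [Fintype κ] [Fintype κ'] (g : κ → ι → MvPolynomial σ K)
    (g' : κ' → ι → MvPolynomial σ K) (c : κ ⊕ κ' → MvPolynomial σ K) :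
    lc (Sum.elim g g') c = lc g (c ∘ Sum.inl) + lc g' (c ∘ Sum.inr) := by
  simp [lc, Fintype.linearCombination_apply, Fintype.sum_sum_type]

theorem lc_map {ι ι' κ : Type} [Fintype κ] (g : κ → ι → MvPolynomial σ K)
    (φ : (ι → MvPolynomial σ K) →ₗ[MvPolynomial σ K] (ι' → MvPolynomial σ K))
    (c : κ → MvPolynomial σ K) :
    φ (lc g c) = lc (fun j => φ (g j)) c := by
  simp [lc, Fintype.linearCombination_apply, map_sum, map_smul]

end basic

/-- A submodule of a graded free module. -/
structure Obj (σ K : Type) [Field K] where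
  ι : Type
  fin : Fintype ι
  dg : ι → ℕ
  N : Submodule (MvPolynomial σ K) (ι → MvPolynomial σ K)

attribute [instance] Obj.fin

section reg
variable {σ K : Type} [Field K]

/-- `Y` is the syzygy object of a generating system of `X` in degrees `≤ d`. -/
def IsGen (X : Obj σ K) (d : ℕ) (Y : Obj σ K) : Prop :=
  ∃ g : Y.ι → X.ι → MvPolynomial σ K,
    (∀ j, g j ∈ X.N ∧ Hom X.dg (Y.dg j) (g j) ∧ Y.dg j ≤ d) ∧
    (∀ n x, x ∈ X.N → Hom X.dg n x → ∃ c, Hom Y.dg n c ∧ lc g c = x) ∧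
    Y.N = LinearMap.ker (lc g)

/-- Regularity at most `d`. -/
def Reg (d : ℕ) (X : Obj σ K) : Prop :=
  ∃ seq : ℕ → Obj σ K, seq 0 = X ∧ ∀ i, IsGen (seq i) (d + i) (seq (i + 1))

theorem IsGen.mono {X Y : Obj σ K} {d d' : ℕ} (h : d ≤ d') (hX : IsGen X d Y) :
    IsGen X d' Y := by
  obtain ⟨g, h1, h2⟩ := hX
  exact ⟨g, fun j => ⟨(h1 j).1, (h1 j).2.1, (h1 j).2.2.trans h⟩, h2⟩

theorem Reg.mono {X : Obj σ K} {d d' : ℕ} (hX : Reg d X) (h : d ≤ d') : Reg d' X := by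
  obtain ⟨s, h0, h1⟩ := hX
  exact ⟨s, h0, fun i => (h1 i).mono (by omega)⟩

theorem Reg.coind (P : Obj σ K → ℕ → Prop)
    (h : ∀ X d, P X d → ∃ Y, IsGen X d Y ∧ P Y (d + 1)) {X : Obj σ K} {d : ℕ} (hX : P X d) :
    Reg d X := by
  choose! Y hY using h
  let s : ℕ → Obj σ K := fun i => Nat.rec X (fun i Z => Y Z (d + i)) i
  have hs : ∀ i, P (s i) (d + i) := by
    intro i
    induction i with
    | zero => exact hX
    | succ i ih => exact (hY _ _ ih).2
  exact ⟨s, rfl, fun i => (hY _ _ (hs i)).1⟩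

theorem Reg.dest {X : Obj σ K} {d : ℕ} (hX : Reg d X) : ∃ Y, IsGen X d Y ∧ Reg (d + 1) Y := by
  obtain ⟨s, rfl, h1⟩ := hX
  exact ⟨s 1, h1 0, fun i => s (i + 1), rfl, fun i => (h1 (i + 1)).mono (by omega)⟩

theorem Reg.of {X Y : Obj σ K} {d : ℕ} (h : IsGen X d Y) (hY : Reg (d + 1) Y) : Reg d X := by
  refine Reg.coind (fun X d => Reg d X ∨ ∃ Y, IsGen X d Y ∧ Reg (d + 1) Y) ?_
    (Or.inr ⟨Y, h, hY⟩)
  rintro X d (h | ⟨Y, h, h'⟩)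
  · obtain ⟨Y, h, h'⟩ := h.dest
    exact ⟨Y, h, Or.inl h'⟩
  · exact ⟨Y, h, Or.inl h'⟩

theorem Reg.zero {X : Obj σ K} (hX : X.N = ⊥) (d : ℕ) : Reg d X := by
  refine Reg.coind (fun X _ => X.N = ⊥) ?_ hX
  intro X d hX
  refine ⟨⟨Empty, inferInstance, fun _ => 0,
    LinearMap.ker (lc (fun j : Empty => (j.elim : X.ι → MvPolynomial σ K)))⟩,
    ⟨fun j => j.elim, fun j => j.elim, ?_, rfl⟩, ?_⟩
  · intro n x hx _
    rw [hX, Submodule.mem_bot] at hx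
    exact ⟨0, Hom.zero _ _, by rw [hx, map_zero]⟩
  · exact Subsingleton.elim _ _

/-- Degree shift. -/
abbrev Obj.shift (X : Obj σ K) (δ : ℕ) : Obj σ K := ⟨X.ι, X.fin, fun i => X.dg i + δ, X.N⟩

theorem Hom.shift {ι : Type} {dg : ι → ℕ} {n δ : ℕ} {f : ι → MvPolynomial σ K} :
    Hom (fun i => dg i + δ) (n + δ) f ↔ Hom dg n f := by
  simp only [Hom, H1.shift]

theorem Hom.shift_cases {ι : Type} {dg : ι → ℕ} {n δ : ℕ} {f : ι → MvPolynomial σ K}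
    (h : Hom (fun i => dg i + δ) n f) : f = 0 ∨ ∃ n', n = n' + δ ∧ Hom dg n' f := by
  by_cases hn : δ ≤ n
  · obtain ⟨n', rfl⟩ := Nat.exists_eq_add_of_le' hn
    exact Or.inr ⟨n', rfl, Hom.shift.1 h⟩
  · left
    funext i
    rcases h i with h | ⟨e, he, _⟩
    · exact h
    · have he : n = dg i + δ + e := he
      omega

theorem IsGen.shift {X Y : Obj σ K} {d : ℕ} (h : IsGen X d Y) (δ : ℕ) :
    IsGen (X.shift δ) (d + δ) (Y.shift δ) := by
  obtain ⟨g, h1, h2, h3⟩ := h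
  refine ⟨g, fun j => ⟨(h1 j).1, Hom.shift.2 (h1 j).2.1, Nat.add_le_add_right (h1 j).2.2 _⟩,
    ?_, h3⟩
  intro n x hx hn
  rcases Hom.shift_cases hn with rfl | ⟨n', rfl, h'⟩
  · exact ⟨0, Hom.zero _ _, map_zero _⟩
  · obtain ⟨c, hc, hc'⟩ := h2 n' x hx h'
    exact ⟨c, Hom.shift.2 hc, hc'⟩

theorem Reg.shift {X : Obj σ K} {d : ℕ} (h : Reg d X) (δ : ℕ) : Reg (d + δ) (X.shift δ) := by
  obtain ⟨s, rfl, h1⟩ := h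
  refine ⟨fun i => (s i).shift δ, rfl, fun i => ?_⟩
  have := (h1 i).shift δ
  rwa [show d + i + δ = d + δ + i by omega] at this

/-- Short exact sequence of graded submodules. -/
structure SES (X1 X X2 : Obj σ K) : Type where
  φ : (X1.ι → MvPolynomial σ K) →ₗ[MvPolynomial σ K] (X.ι → MvPolynomial σ K)
  ψ : (X.ι → MvPolynomial σ K) →ₗ[MvPolynomial σ K] (X2.ι → MvPolynomial σ K)
  φN : ∀ z ∈ X1.N, φ z ∈ X.N
  φH : ∀ n, ∀ z ∈ X1.N, Hom X1.dg n z → Hom X.dg n (φ z)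
  φinj : ∀ z ∈ X1.N, φ z = 0 → z = 0
  ψN : ∀ x ∈ X.N, ψ x ∈ X2.N
  ψH : ∀ n, ∀ x ∈ X.N, Hom X.dg n x → Hom X2.dg n (ψ x)
  ψφ : ∀ z ∈ X1.N, ψ (φ z) = 0
  ex : ∀ n, ∀ x ∈ X.N, Hom X.dg n x → ψ x = 0 → ∃ z ∈ X1.N, Hom X1.dg n z ∧ φ z = x
  surj : ∀ n, ∀ y ∈ X2.N, Hom X2.dg n y → ∃ x ∈ X.N, Hom X.dg n x ∧ ψ x = y

/-- Inclusion of the left block. -/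
def inlMap (κ κ' : Type) : (κ → MvPolynomial σ K) →ₗ[MvPolynomial σ K]
    (κ ⊕ κ' → MvPolynomial σ K) where
  toFun c := Sum.elim c 0
  map_add' a b := by funext i; cases i <;> simp
  map_smul' a b := by funext i; cases i <;> simp

/-- Projection on the right block. -/
def inrProj (κ κ' : Type) : (κ ⊕ κ' → MvPolynomial σ K) →ₗ[MvPolynomial σ K]
    (κ' → MvPolynomial σ K) where
  toFun c := c ∘ Sum.inr
  map_add' _ _ := rfl
  map_smul' _ _ := rfl

theorem inlMap_apply {κ κ' : Type} (c : κ → MvPolynomial σ K) :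
    inlMap κ κ' c = Sum.elim c 0 := rfl
theorem inrProj_apply {κ κ' : Type} (c : κ ⊕ κ' → MvPolynomial σ K) :
    inrProj κ κ' c = c ∘ Sum.inr := rfl

theorem Hom.elim {κ κ' : Type} {d1 : κ → ℕ} {d2 : κ' → ℕ} {n : ℕ}
    {a : κ → MvPolynomial σ K} {b : κ' → MvPolynomial σ K} (ha : Hom d1 n a) (hb : Hom d2 n b) :
    Hom (Sum.elim d1 d2) n (Sum.elim a b) := by
  rintro (i | i)
  · exact ha i
  · exact hb i

theorem SES.step {X1 X X2 Y1 Y2 : Obj σ K} (s : SES X1 X X2) {d : ℕ} (h1 : IsGen X1 d Y1)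
    (h2 : IsGen X2 d Y2) : ∃ Y, IsGen X d Y ∧ Nonempty (SES Y1 Y Y2) := by
  obtain ⟨g1, a1, b1, c1⟩ := h1
  obtain ⟨g2, a2, b2, c2⟩ := h2
  have hx : ∀ j, ∃ x ∈ X.N, Hom X.dg (Y2.dg j) x ∧ s.ψ x = g2 j := fun j =>
    s.surj _ _ (a2 j).1 (a2 j).2.1
  choose x xN xH xψ using hx
  let g : Y1.ι ⊕ Y2.ι → X.ι → MvPolynomial σ K := Sum.elim (fun j => s.φ (g1 j)) x
  have hψ : ∀ c, s.ψ (lc x c) = lc g2 c := by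
    intro c
    rw [lc_map]
    simp only [xψ]
  have hφ : ∀ c, lc (fun j => s.φ (g1 j)) c = s.φ (lc g1 c) := fun c => (lc_map _ _ _).symm
  have hg1 : ∀ c, lc g1 c ∈ X1.N := lc_mem fun j => (a1 j).1
  have hlx : ∀ c, lc x c ∈ X.N := lc_mem xN
  refine ⟨⟨Y1.ι ⊕ Y2.ι, inferInstance, Sum.elim Y1.dg Y2.dg, LinearMap.ker (lc g)⟩,
    ⟨g, ?_, ?_, rfl⟩, ⟨⟨inlMap _ _, inrProj _ _, ?_, ?_, ?_, ?_, ?_, ?_, ?_, ?_⟩⟩⟩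
  · rintro (j | j)
    · exact ⟨s.φN _ (a1 j).1, s.φH _ _ (a1 j).1 (a1 j).2.1, (a1 j).2.2⟩
    · exact ⟨xN j, xH j, (a2 j).2.2⟩
  · intro n y hy hn
    obtain ⟨e2, he2, he2'⟩ := b2 n (s.ψ y) (s.ψN _ hy) (s.ψH _ _ hy hn)
    obtain ⟨z, hz, hzn, hzφ⟩ := s.ex n (y - lc x e2) (X.N.sub_mem hy (hlx _))
      (hn.sub (Hom.lc xH he2)) (by rw [map_sub, hψ, he2', sub_self])
    obtain ⟨e1, he1, he1'⟩ := b1 n z hz hzn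
    refine ⟨Sum.elim e1 e2, Hom.elim he1 he2, ?_⟩
    rw [lc_sum, Sum.elim_comp_inl, Sum.elim_comp_inr, hφ, he1', hzφ]
    abel
  · intro z hz
    rw [c1] at hz
    rw [LinearMap.mem_ker] at hz ⊢
    rw [inlMap_apply, lc_sum, Sum.elim_comp_inl, Sum.elim_comp_inr, hφ, hz]
    simp
  · intro n z _ hn
    exact Hom.elim hn (Hom.zero _ _)
  · intro z _ h
    funext i
    exact congrFun h (Sum.inl i)
  · intro y hy
    rw [c2]
    rw [LinearMap.mem_ker] at hy ⊢
    rw [lc_sum, hφ] at hy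
    have := congrArg s.ψ hy
    rw [map_add, map_zero, s.ψφ _ (hg1 _), zero_add, hψ] at this
    exact this
  · intro n y _ hn j
    exact hn (Sum.inr j)
  · intro z _
    rfl
  · intro n y hy hn h0
    rw [LinearMap.mem_ker, lc_sum] at hy
    have h0' : y ∘ Sum.inr = 0 := h0
    refine ⟨y ∘ Sum.inl, ?_, fun j => hn (Sum.inl j), ?_⟩
    · rw [c1, LinearMap.mem_ker]
      rw [h0', map_zero, add_zero, hφ] at hy
      exact s.φinj _ (hg1 _) hy
    · funext i
      rcases i with i | i
      · rfl
      · exact (congrFun h0' i).symm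
  · intro n y hy hn
    rw [c2, LinearMap.mem_ker] at hy
    obtain ⟨z, hz, hzn, hzφ⟩ := s.ex n (lc x y) (hlx _) (Hom.lc xH hn) (by rw [hψ, hy])
    obtain ⟨e1, he1, he1'⟩ := b1 n z hz hzn
    refine ⟨Sum.elim (-e1) y, ?_, Hom.elim he1.neg hn, ?_⟩
    · rw [LinearMap.mem_ker, lc_sum, Sum.elim_comp_inl, Sum.elim_comp_inr, hφ, map_neg, map_neg,
        he1', hzφ]
      simp
    · rfl

theorem SES.reg {X1 X X2 : Obj σ K} (s : SES X1 X X2) {d : ℕ} (h1 : Reg d X1)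
    (h2 : Reg d X2) : Reg d X := by
  refine Reg.coind (fun X d => ∃ X1 X2, Reg d X1 ∧ Reg d X2 ∧ Nonempty (SES X1 X X2)) ?_
    ⟨X1, X2, h1, h2, ⟨s⟩⟩
  rintro X d ⟨X1, X2, h1, h2, ⟨s⟩⟩
  obtain ⟨Y1, h1, h1'⟩ := h1.dest
  obtain ⟨Y2, h2, h2'⟩ := h2.dest
  obtain ⟨Y, hY, hs⟩ := s.step h1 h2
  exact ⟨Y, hY, Y1, Y2, h1', h2', hs⟩

/-- An ideal as an object. -/
abbrev idl (I : Ideal (MvPolynomial σ K)) : Obj σ K :=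
  ⟨Unit, inferInstance, fun _ => 0, Submodule.comap (LinearMap.proj ()) I⟩

theorem mem_idl {I : Ideal (MvPolynomial σ K)} {x : Unit → MvPolynomial σ K} :
    x ∈ (idl I).N ↔ x () ∈ I := Iff.rfl

end reg
end RegAux

namespace RegAux
open EdgeIdealReg

/-! ## Part 2: monomial ideals -/
section mono
variable {σ : Type} (K : Type) [Field K]

/-- Monomial ideal with exponents in `U`. -/
def MI (U : Set (σ →₀ ℕ)) : Ideal (MvPolynomial σ K) :=
  Ideal.span (Set.image (fun s => monomial s (1 : K)) U)

variable {K}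

theorem mem_MI {U : Set (σ →₀ ℕ)} (hU : IsUpperSet U) {f : MvPolynomial σ K} :
    f ∈ MI K U ↔ ∀ e ∈ f.support, e ∈ U := by
  rw [MI, mem_ideal_span_monomial_image]
  constructor
  · intro h e he
    obtain ⟨u, hu, hue⟩ := h e he
    exact hU hue hu
  · intro h e he
    exact ⟨e, h e he, le_rfl⟩

theorem monomial_mem_MI {U : Set (σ →₀ ℕ)} {e : σ →₀ ℕ} (he : e ∈ U) (c : K) :
    monomial e c ∈ MI K U := by
  have : monomial e c = C c * monomial e (1 : K) := by
    rw [C_mul_monomial, mul_one]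
  rw [this]
  exact Ideal.mul_mem_left _ _ (Ideal.subset_span ⟨e, he, rfl⟩)

theorem upper_colon {U : Set (σ →₀ ℕ)} (hU : IsUpperSet U) (b : σ →₀ ℕ) :
    IsUpperSet {e | b + e ∈ U} := by
  intro e e' h he
  exact hU (add_le_add_right h b) he

theorem MI_colon {U : Set (σ →₀ ℕ)} (hU : IsUpperSet U) (b : σ →₀ ℕ) (f : MvPolynomial σ K) :
    f ∈ MI K {e | b + e ∈ U} ↔ f * monomial b 1 ∈ MI K U := by
  rw [mem_MI hU, mem_MI (upper_colon hU b)]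
  constructor
  · intro h e he
    rw [mem_support_iff, coeff_mul_monomial'] at he
    split_ifs at he with hb
    · have := h (e - b) (by rw [mem_support_iff]; simpa using he)
      simpa [add_tsub_cancel_of_le hb] using this
    · exact absurd rfl he
  · intro h e he
    have := h (e + b) (by
      rw [mem_support_iff, coeff_mul_monomial]
      simpa using mem_support_iff.1 he)
    show b + e ∈ U
    rwa [add_comm]

theorem MI_split {U : Set (σ →₀ ℕ)} (hU : IsUpperSet U) (b : σ →₀ ℕ) {f : MvPolynomial σ K}
    {n : ℕ} (hf : f ∈ MI K (U ∪ Set.Ici b)) (hn : H1 0 n f) :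
    ∃ h s, h ∈ MI K U ∧ H1 0 n h ∧ H1 b.degree n s ∧ f = h + s * monomial b 1 := by
  classical
  rw [mem_MI (hU.union (isUpperSet_Ici b))] at hf
  have hdeg : ∀ e ∈ f.support, e.degree = n := by
    intro e he
    rcases hn with rfl | ⟨m, hm, hn⟩
    · simp at he
    · by_contra hne
      exact mem_support_iff.1 he (hn.coeff_eq_zero (by omega))
  refine ⟨∑ e ∈ f.support with e ∈ U, monomial e (coeff e f),
    ∑ e ∈ f.support with ¬ e ∈ U, monomial (e - b) (coeff e f), ?_, ?_, ?_, ?_⟩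
  · exact Ideal.sum_mem _ fun e he => monomial_mem_MI (Finset.mem_filter.1 he).2 _
  · refine H1.sum _ fun e he => Or.inr ⟨n, by omega, isHomogeneous_monomial _ ?_⟩
    exact hdeg e (Finset.mem_filter.1 he).1
  · refine H1.sum _ fun e he => Or.inr ⟨(e - b).degree, ?_, isHomogeneous_monomial _ rfl⟩
    obtain ⟨he, heU⟩ := Finset.mem_filter.1 he
    have hb : b ≤ e := (hf e he).resolve_left heU
    rw [← hdeg e he, ← map_add, add_tsub_cancel_of_le hb]
  · rw [Finset.sum_mul]
    have : ∑ e ∈ f.support with ¬ e ∈ U, monomial (e - b) (coeff e f) * monomial b 1 =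
        ∑ e ∈ f.support with ¬ e ∈ U, monomial e (coeff e f) := by
      refine Finset.sum_congr rfl fun e he => ?_
      obtain ⟨he, heU⟩ := Finset.mem_filter.1 he
      have hb : b ≤ e := (hf e he).resolve_left heU
      rw [monomial_mul, mul_one, tsub_add_cancel_of_le hb]
    rw [this, Finset.sum_filter_add_sum_filter_not, support_sum_monomial_coeff]

theorem MI_mono {U U' : Set (σ →₀ ℕ)} (h : U ⊆ U') : MI K U ≤ MI K U' :=
  Ideal.span_mono (Set.image_mono h)

theorem H1_of_hom {n : ℕ} {f : Unit → MvPolynomial σ K} {dg : Unit → ℕ}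
    (h : H1 (dg ()) n (f ())) : Hom dg n f := fun _ => h

variable (K) in
/-- Regularity of the monomial ideal of `U` at most `d`. -/
def RegU (d : ℕ) (U : Set (σ →₀ ℕ)) : Prop := Reg d (idl (MI K U))

theorem RegU.mono {d d' : ℕ} {U : Set (σ →₀ ℕ)} (h : RegU K d U) (hd : d ≤ d') : RegU K d' U :=
  Reg.mono h hd

theorem monomial_one_ne (b : σ →₀ ℕ) : (monomial b (1 : K)) ≠ 0 := by
  rw [Ne, monomial_eq_zero]; exact one_ne_zero

theorem regU_Ici (b : σ →₀ ℕ) : RegU K b.degree (Set.Ici b) := by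
  let g : Unit → (idl (MI K (Set.Ici b))).ι → MvPolynomial σ K := fun _ _ => monomial b 1
  refine Reg.of (Y := ⟨Unit, inferInstance, fun _ => b.degree, LinearMap.ker (lc g)⟩)
    ⟨g, ?_, ?_, rfl⟩ (Reg.zero ?_ _)
  · intro j
    refine ⟨monomial_mem_MI (Set.self_mem_Ici) _, fun _ => Or.inr ⟨b.degree, ?_, ?_⟩, le_rfl⟩
    · simp [idl]
    · exact isHomogeneous_monomial _ rfl
  · intro n x hx hn
    obtain ⟨h, s, hh, _, hs, hx'⟩ := MI_split (U := ∅) isUpperSet_empty b (f := x ())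
      (by simpa using hx) (hn ())
    have h0 : h = 0 := by
      simpa [MI] using hh
    refine ⟨fun _ => s, fun _ => hs, ?_⟩
    funext i
    rw [lc_apply]
    cases i
    simp [g, hx', h0]
  · rw [Submodule.eq_bot_iff]
    intro x hx
    have hx : lc g x = 0 := hx
    have := congrFun hx ()
    rw [lc_apply] at this
    simp only [Finset.univ_unique, Finset.sum_singleton, g, Pi.zero_apply, mul_eq_zero,
      monomial_one_ne, or_false] at this
    funext i
    exact this

/-- The main exchange lemma: `reg J` from `reg (J : m)` and `reg (J + m)`. -/
theorem regU_step {U : Set (σ →₀ ℕ)} (hU : IsUpperSet U) (b : σ →₀ ℕ) {dA d : ℕ}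
    (hA : RegU K dA {e | b + e ∈ U}) (hd : dA + b.degree ≤ d)
    (hB : RegU K d (U ∪ Set.Ici b)) (hd' : b.degree ≤ d + 1) : RegU K d U := by
  obtain ⟨YA, ⟨gA, a1, a2, a3⟩, rA⟩ := Reg.dest hA
  obtain ⟨YB, ⟨gB, b1, b2, b3⟩, rB⟩ := Reg.dest hB
  set m : MvPolynomial σ K := monomial b 1 with hm
  have hm0 : m ≠ 0 := monomial_one_ne b
  have hmH : H1 0 b.degree m := Or.inr ⟨b.degree, by simp, isHomogeneous_monomial _ rfl⟩
  have hs : ∀ j, ∃ h s, h ∈ MI K U ∧ H1 0 (YB.dg j) h ∧ H1 b.degree (YB.dg j) s ∧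
      gB j () = h + s * m := fun j => MI_split hU b (b1 j).1 ((b1 j).2.1 ())
  choose h s hJ hH sH hgB using hs
  let g : YA.ι ⊕ YB.ι → Unit → MvPolynomial σ K :=
    Sum.elim (fun i _ => gA i () * m) (fun j _ => h j)
  have lgA : ∀ c, lc (fun i _ => gA i () * m : YA.ι → Unit → MvPolynomial σ K) c =
      fun _ => lc gA c () * m := by
    intro c
    funext i
    rw [lc_apply, lc_apply, Finset.sum_mul]
    exact Finset.sum_congr rfl fun j _ => by ring
  have lgB : ∀ c, lc gB c () = lc (fun j _ => h j : YB.ι → Unit → MvPolynomial σ K) c () +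
      (∑ j, c j * s j) * m := by
    intro c
    rw [lc_apply, lc_apply, Finset.sum_mul, ← Finset.sum_add_distrib]
    exact Finset.sum_congr rfl fun j _ => by rw [hgB]; ring
  have lhJ : ∀ c, lc (fun j _ => h j : YB.ι → Unit → MvPolynomial σ K) c () ∈ MI K U := by
    intro c
    rw [lc_apply]
    exact Ideal.sum_mem _ fun j _ => Ideal.mul_mem_left _ _ (hJ j)
  have lhH : ∀ c n, Hom YB.dg n c → H1 0 n
      (lc (fun j _ => h j : YB.ι → Unit → MvPolynomial σ K) c ()) := by
    intro c n hc
    rw [lc_apply]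
    exact H1.sum _ fun j _ => (hH j).mul (hc j)
  have lsH : ∀ c n, Hom YB.dg n c → H1 b.degree n (∑ j, c j * s j) := by
    intro c n hc
    exact H1.sum _ fun j _ => (sH j).mul (hc j)
  -- expressing an element of the colon ideal
  have colA : ∀ t n, H1 b.degree n t → t * m ∈ MI K U →
      ∃ α, Hom (YA.shift b.degree).dg n α ∧ lc gA α () = t := by
    intro t n ht htm
    rw [← MI_colon hU] at htm
    rcases ht with rfl | ⟨e, rfl, ht⟩
    · exact ⟨0, Hom.zero _ _, by simp⟩
    · obtain ⟨α, hα, hα'⟩ := a2 e (fun _ => t) htm (fun _ => Or.inr ⟨e, by simp [idl], ht⟩)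
      refine ⟨α, ?_, by rw [hα']⟩
      rw [add_comm]
      exact Hom.shift.2 hα
  have mA : ∀ α, lc gA α () * m ∈ MI K U := by
    intro α
    rw [← MI_colon hU]
    exact lc_mem (N := (idl (MI K {e | b + e ∈ U})).N) (fun j => (a1 j).1) α
  refine Reg.of (Y := ⟨YA.ι ⊕ YB.ι, inferInstance, Sum.elim (YA.shift b.degree).dg YB.dg,
    LinearMap.ker (lc g)⟩) ⟨g, ?_, ?_, rfl⟩ ?_
  · rintro (i | j)
    · refine ⟨?_, ?_, ?_⟩
      · show gA i () * m ∈ MI K U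
        rw [← MI_colon hU]
        exact (a1 i).1
      · intro _
        have h1 : H1 b.degree (YA.dg i + b.degree) (gA i ()) := by
          have := (H1.shift (δ := b.degree)).2 ((a1 i).2.1 ())
          simpa [idl] using this
        exact hmH.mul h1
      · exact (Nat.add_le_add_right (a1 i).2.2 _).trans hd
    · exact ⟨hJ j, fun _ => hH j, (b1 j).2.2⟩
  · intro n x hx hn
    obtain ⟨c, hc, hc'⟩ := b2 n x (MI_mono Set.subset_union_left hx) hn
    have hx' := lgB c
    rw [hc'] at hx'
    obtain ⟨α, hα, hα'⟩ := colA (∑ j, c j * s j) n (lsH c n hc) (by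
      have : (∑ j, c j * s j) * m = x () -
        lc (fun j _ => h j : YB.ι → Unit → MvPolynomial σ K) c () := by rw [hx']; ring
      rw [this]
      exact Ideal.sub_mem _ hx (lhJ c))
    refine ⟨Sum.elim α c, Hom.elim hα hc, ?_⟩
    rw [lc_sum, Sum.elim_comp_inl, Sum.elim_comp_inr, lgA]
    funext i
    cases i
    rw [Pi.add_apply, hα', hx']
    ring
  -- the syzygies
  let N' : Obj σ K := ⟨YB.ι, YB.fin, YB.dg,
    Submodule.comap (lc gB) (idl (MI K (Set.Ici b))).N⟩
  have memN' : ∀ β, β ∈ N'.N ↔ lc gB β () ∈ MI K (Set.Ici b) := fun _ => Iff.rfl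
  have mIci : ∀ t, t * m ∈ MI K (Set.Ici b) := fun t =>
    Ideal.mul_mem_left _ _ (monomial_mem_MI Set.self_mem_Ici _)
  have rN' : Reg (d + 1) N' := by
    refine SES.reg (X1 := YB) (X := N') (X2 := idl (MI K (Set.Ici b)))
      ⟨LinearMap.id, lc gB, ?_, ?_, ?_, ?_, ?_, ?_, ?_, ?_⟩ rB (Reg.mono (regU_Ici b) hd')
    · intro z hz
      rw [b3, LinearMap.mem_ker] at hz
      show lc gB z () ∈ MI K (Set.Ici b)
      rw [hz]
      exact Ideal.zero_mem _
    · intro n z _ hz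
      exact hz
    · intro z _ hz
      exact hz
    · intro x hx
      exact hx
    · intro n x _ hn
      exact Hom.lc (fun j => (b1 j).2.1) hn
    · intro z hz
      rw [b3] at hz
      exact hz
    · intro n x _ hn h0
      exact ⟨x, by rw [b3]; exact h0, hn, rfl⟩
    · intro n y hy hn
      obtain ⟨c, hc, hc'⟩ := b2 n y (MI_mono Set.subset_union_right hy) hn
      exact ⟨c, by rw [memN', hc']; exact hy, hc, hc'⟩
  refine SES.reg (X1 := YA.shift b.degree) (X2 := N')
    ⟨inlMap _ _, inrProj _ _, ?_, ?_, ?_, ?_, ?_, ?_, ?_, ?_⟩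
    ((rA.shift b.degree).mono (by omega)) rN'
  · intro z hz
    have hz : lc gA z = 0 := by
      have : z ∈ YA.N := hz
      rwa [a3] at this
    show lc g _ = 0
    rw [inlMap_apply, lc_sum]
    erw [Sum.elim_comp_inl, Sum.elim_comp_inr]
    rw [lgA, hz]
    funext i
    simp
  · intro n z _ hn
    exact Hom.elim hn (Hom.zero _ _)
  · intro z _ h
    funext i
    exact congrFun h (Sum.inl i)
  · intro y hy
    have hy : lc g y = 0 := hy
    rw [lc_sum, lgA] at hy
    have hy := congrFun hy ()
    show lc gB (y ∘ Sum.inr) () ∈ MI K (Set.Ici b)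
    rw [lgB]
    have : lc (fun j _ => h j : YB.ι → Unit → MvPolynomial σ K) (y ∘ Sum.inr) () =
      (- lc gA (y ∘ Sum.inl) ()) * m := by
      rw [neg_mul, eq_neg_iff_add_eq_zero, add_comm]
      exact hy
    rw [this]
    exact Ideal.add_mem _ (mIci _) (mIci _)
  · intro n y _ hn j
    exact hn (Sum.inr j)
  · intro z _
    rfl
  · intro n y hy hn h0
    have hy : lc g y = 0 := hy
    rw [lc_sum, lgA] at hy
    have h0' : y ∘ Sum.inr = 0 := h0
    refine ⟨y ∘ Sum.inl, ?_, fun j => hn (Sum.inl j), ?_⟩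
    · show y ∘ Sum.inl ∈ YA.N
      rw [a3, LinearMap.mem_ker]
      rw [h0', map_zero, add_zero] at hy
      funext i
      exact (mul_eq_zero.1 (congrFun hy i)).resolve_right hm0
    · funext i
      rcases i with i | i
      · rfl
      · exact (congrFun h0' i).symm
  · intro n β hβ hn
    rw [memN'] at hβ
    obtain ⟨h', t, hh', _, ht, hβ'⟩ := MI_split (U := ∅) isUpperSet_empty b (f := lc gB β ())
      (by simpa using hβ) (n := n) (Hom.lc (dg := fun _ => 0) (fun j => (b1 j).2.1) hn ())
    have h0 : h' = 0 := by
      simpa [MI] using hh'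
    rw [h0, zero_add, lgB] at hβ'
    obtain ⟨α, hα, hα'⟩ := colA (t - ∑ j, β j * s j) n (ht.sub (lsH β n hn)) (by
      have : (t - ∑ j, β j * s j) * m =
        lc (fun j _ => h j : YB.ι → Unit → MvPolynomial σ K) β () := by
        rw [sub_mul, hm, ← hβ']; ring
      rw [this]
      exact lhJ _)
    refine ⟨Sum.elim (-α) β, ?_, Hom.elim hα.neg hn, rfl⟩
    show lc g _ = 0
    rw [lc_sum, Sum.elim_comp_inl, Sum.elim_comp_inr, lgA, map_neg]
    funext i
    cases i
    show (-(lc gA α ())) * m + lc (fun j _ => h j : YB.ι → Unit → MvPolynomial σ K) β () = 0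
    rw [hα', ← sub_eq_zero.2 hβ']
    ring

/-- Mapping cone: `reg (J + m)` from `reg J` and `reg (J : m)`. -/
theorem regU_cone {U : Set (σ →₀ ℕ)} (hU : IsUpperSet U) (b : σ →₀ ℕ) {dA d : ℕ}
    (hA : RegU K dA {e | b + e ∈ U}) (hd : dA + b.degree ≤ d + 1)
    (hJ : RegU K d U) (hd' : b.degree ≤ d) : RegU K d (U ∪ Set.Ici b) := by
  obtain ⟨Y, ⟨g, a1, a2, a3⟩, rY⟩ := Reg.dest hJ
  set m : MvPolynomial σ K := monomial b 1 with hm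
  have hmH : H1 0 b.degree m := Or.inr ⟨b.degree, by simp, isHomogeneous_monomial _ rfl⟩
  have lgm : ∀ c : Unit → MvPolynomial σ K,
      lc (fun _ _ => m : Unit → Unit → MvPolynomial σ K) c = fun _ => c () * m := by
    intro c
    funext i
    rw [lc_apply]
    simp
  have gN : ∀ c, lc g c () ∈ MI K U := fun c =>
    lc_mem (N := (idl (MI K U)).N) (fun j => (a1 j).1) c
  refine Reg.of (Y := ⟨Y.ι ⊕ Unit, inferInstance, Sum.elim Y.dg (fun _ => b.degree),
    LinearMap.ker (lc (Sum.elim g (fun _ _ => m)))⟩) ⟨Sum.elim g (fun _ _ => m), ?_, ?_, rfl⟩ ?_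
  · rintro (j | j)
    · exact ⟨MI_mono Set.subset_union_left (a1 j).1, (a1 j).2.1, (a1 j).2.2⟩
    · exact ⟨monomial_mem_MI (Or.inr Set.self_mem_Ici) _, fun _ => hmH, hd'⟩
  · intro n x hx hn
    obtain ⟨h, s, hh, hhn, hs, hx'⟩ := MI_split hU b (f := x ()) hx (hn ())
    obtain ⟨c, hc, hc'⟩ := a2 n (fun _ => h) hh (fun _ => hhn)
    refine ⟨Sum.elim c (fun _ => s), Hom.elim hc (fun _ => hs), ?_⟩
    rw [lc_sum, Sum.elim_comp_inl, Sum.elim_comp_inr, hc']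
    erw [lgm]
    funext i
    exact hx'.symm
  refine SES.reg (X1 := Y) (X2 := (idl (MI K {e | b + e ∈ U})).shift b.degree)
    ⟨inlMap _ _, inrProj _ _, ?_, ?_, ?_, ?_, ?_, ?_, ?_, ?_⟩
    rY ((Reg.shift hA b.degree).mono hd)
  · intro z hz
    rw [a3, LinearMap.mem_ker] at hz
    rw [LinearMap.mem_ker, inlMap_apply, lc_sum, Sum.elim_comp_inl, Sum.elim_comp_inr, hz]
    simp
  · intro n z _ hn
    exact Hom.elim hn (Hom.zero _ _)
  · intro z _ h
    funext i
    exact congrFun h (Sum.inl i)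
  · intro y hy
    rw [LinearMap.mem_ker, lc_sum] at hy
    show y (Sum.inr ()) ∈ MI K {e | b + e ∈ U}
    rw [MI_colon hU]
    erw [lgm] at hy
    have hy := congrFun hy ()
    have : y (Sum.inr ()) * m = - lc g (y ∘ Sum.inl) () := by
      rw [eq_neg_iff_add_eq_zero, add_comm]
      exact hy
    rw [this]
    exact Ideal.neg_mem_iff _ |>.2 (gN _)
  · intro n y _ hn j
    have := hn (Sum.inr ())
    show H1 (0 + b.degree) n (y (Sum.inr ()))
    rw [zero_add]
    exact this
  · intro z _
    rfl
  · intro n y hy hn h0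
    rw [LinearMap.mem_ker, lc_sum] at hy
    have h0' : y ∘ Sum.inr = 0 := h0
    refine ⟨y ∘ Sum.inl, ?_, fun j => hn (Sum.inl j), ?_⟩
    · rw [a3, LinearMap.mem_ker]
      rw [h0', map_zero, add_zero] at hy
      exact hy
    · funext i
      rcases i with i | i
      · rfl
      · exact (congrFun h0' i).symm
  · intro n y hy hn
    have hy : y () ∈ MI K {e | b + e ∈ U} := hy
    rw [MI_colon hU] at hy
    have hyH : H1 b.degree n (y ()) := by
      have : H1 (0 + b.degree) n (y ()) := hn ()
      rwa [zero_add] at this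
    obtain ⟨c, hc, hc'⟩ := a2 n (fun _ => y () * m) hy (fun _ => hmH.mul hyH)
    refine ⟨Sum.elim (-c) (fun _ => y ()), ?_, Hom.elim hc.neg (fun _ => hyH), rfl⟩
    rw [LinearMap.mem_ker, lc_sum, Sum.elim_comp_inl, Sum.elim_comp_inr, map_neg, hc']
    erw [lgm]
    funext i
    simp

theorem regU_empty (d : ℕ) : RegU K d (∅ : Set (σ →₀ ℕ)) := by
  refine Reg.zero ?_ d
  rw [Submodule.eq_bot_iff]
  intro x hx
  have hx : x () ∈ MI K ∅ := hx
  funext i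
  simpa [MI] using hx

theorem regU_univ (d : ℕ) : RegU K d (Set.univ : Set (σ →₀ ℕ)) := by
  have := (regU_Ici (K := K) (0 : σ →₀ ℕ)).mono (d' := d) (by simp)
  have h : Set.Ici (0 : σ →₀ ℕ) = Set.univ := by ext; simp
  rwa [h] at this

end mono
end RegAux

namespace RegAux
open EdgeIdealReg

/-! ## Part 3: from `Reg` to graded free resolutions -/
section res
variable {σ K : Type} [Field K]

/-- Homogeneous component with shifted degree. -/
def comp1 (a n : ℕ) (s : MvPolynomial σ K) : MvPolynomial σ K :=
  if a ≤ n then homogeneousComponent (n - a) s else 0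

theorem coeff_comp1 (a n : ℕ) (s : MvPolynomial σ K) (e : σ →₀ ℕ) :
    coeff e (comp1 a n s) = if n = a + e.degree then coeff e s else 0 := by
  unfold comp1
  by_cases h : a ≤ n
  · rw [if_pos h, coeff_homogeneousComponent]
    by_cases h' : n = a + e.degree
    · rw [if_pos h', if_pos (by omega)]
    · rw [if_neg h', if_neg (by omega)]
  · rw [if_neg h, if_neg (by omega)]
    simp

theorem comp1_sum {ι : Type} (u : Finset ι) (a n : ℕ) (s : ι → MvPolynomial σ K) :
    comp1 a n (∑ i ∈ u, s i) = ∑ i ∈ u, comp1 a n (s i) := by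
  unfold comp1
  split_ifs
  · rw [map_sum]
  · simp

theorem comp1_mul {a b n : ℕ} {s : MvPolynomial σ K} (hs : H1 a b s) (c : MvPolynomial σ K) :
    comp1 a n (c * s) = comp1 b n c * s := by
  rcases hs with rfl | ⟨e, rfl, hs⟩
  · simp [comp1]
  have hs' : s ∈ homogeneousSubmodule σ K e := hs
  letI : GradedAlgebra (homogeneousSubmodule σ K) := MvPolynomial.gradedAlgebra
  have key : ∀ (f : MvPolynomial σ K) (k : ℕ), homogeneousComponent k f =
      (DirectSum.decompose (homogeneousSubmodule σ K) f k : MvPolynomial σ K) :=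
    fun f k => (decomposition.decompose'_apply f k).symm
  unfold comp1
  by_cases h : a ≤ n
  · rw [if_pos h]
    by_cases h' : a + e ≤ n
    · rw [if_pos h']
      have := DirectSum.coe_decompose_mul_of_right_mem_of_le (homogeneousSubmodule σ K)
        (a := c) hs' (n := n - a) (by omega)
      rw [key, key]
      rw [show n - (a + e) = n - a - e by omega]
      exact this
    · rw [if_neg h', zero_mul]
      have := DirectSum.coe_decompose_mul_of_right_mem_of_not_le (homogeneousSubmodule σ K)
        (a := c) hs' (n := n - a) (by omega)
      rw [key]
      exact this
  · rw [if_neg h, if_neg (by omega), zero_mul]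

/-- Homogeneous component of a vector. -/
def comp {ι : Type} (dg : ι → ℕ) (n : ℕ) (x : ι → MvPolynomial σ K) : ι → MvPolynomial σ K :=
  fun i => comp1 (dg i) n (x i)

theorem comp_hom {ι : Type} (dg : ι → ℕ) (n : ℕ) (x : ι → MvPolynomial σ K) :
    Hom dg n (comp dg n x) := by
  intro i
  unfold comp comp1
  split_ifs with h
  · exact Or.inr ⟨n - dg i, by omega, homogeneousComponent_isHomogeneous _ _⟩
  · exact Or.inl rfl

theorem comp_lc {ι κ : Type} [Fintype κ] {g : κ → ι → MvPolynomial σ K} {dg : ι → ℕ}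
    {dg' : κ → ℕ} (hg : ∀ j, Hom dg (dg' j) (g j)) (n : ℕ) (c : κ → MvPolynomial σ K) :
    lc g (comp dg' n c) = comp dg n (lc g c) := by
  funext i
  unfold comp
  rw [lc_apply, lc_apply, comp1_sum]
  exact Finset.sum_congr rfl fun j _ => (comp1_mul (hg j i) (c j)).symm

theorem sum_comp {ι : Type} [Fintype ι] (dg : ι → ℕ) (x : ι → MvPolynomial σ K) :
    ∃ M, x = ∑ n ∈ Finset.range M, comp dg n x := by
  refine ⟨(∑ i, (dg i + (x i).totalDegree)) + 1, ?_⟩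
  funext i
  rw [Finset.sum_apply]
  ext e
  rw [coeff_sum]
  simp only [comp, coeff_comp1]
  rw [Finset.sum_ite_eq']
  split_ifs with h
  · rfl
  · by_contra hne
    apply h
    rw [Finset.mem_range]
    have h1 : e.degree ≤ (x i).totalDegree := by
      have := le_totalDegree (mem_support_iff.2 hne)
      exact this
    have h2 : dg i + (x i).totalDegree ≤ ∑ i, (dg i + (x i).totalDegree) :=
      Finset.single_le_sum (f := fun i => dg i + (x i).totalDegree) (fun _ _ => Nat.zero_le _)
        (Finset.mem_univ i)
    omega

/-- Graded submodule. -/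
def GR (X : Obj σ K) : Prop := ∀ x ∈ X.N, ∀ n, comp X.dg n x ∈ X.N

theorem range_of_GR {X : Obj σ K} (hX : GR X) {κ : Type} [Fintype κ]
    {g : κ → X.ι → MvPolynomial σ K} {dg : κ → ℕ} (h : ∀ n x, x ∈ X.N → Hom X.dg n x →
      ∃ c, Hom dg n c ∧ lc g c = x) {x} (hx : x ∈ X.N) : x ∈ LinearMap.range (lc g) := by
  obtain ⟨M, hM⟩ := sum_comp X.dg x
  rw [hM]
  refine Submodule.sum_mem _ fun n _ => ?_
  obtain ⟨c, _, hc⟩ := h n _ (hX x hx n) (comp_hom _ _ _)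
  exact ⟨c, hc⟩

theorem GR_gen {X Y : Obj σ K} {d : ℕ} (h : IsGen X d Y) : GR Y := by
  obtain ⟨g, h1, _, h3⟩ := h
  intro x hx n
  rw [h3] at hx ⊢
  rw [LinearMap.mem_ker] at hx ⊢
  rw [comp_lc (fun j => (h1 j).2.1), hx]
  funext i
  simp [comp, comp1]

theorem GR_MI {U : Set (σ →₀ ℕ)} (hU : IsUpperSet U) : GR (idl (MI K U)) := by
  intro x hx n
  have hx : x () ∈ MI K U := hx
  show comp1 0 n (x ()) ∈ MI K U
  rw [mem_MI hU] at hx ⊢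
  intro e he
  rw [mem_support_iff, coeff_comp1] at he
  refine hx e (mem_support_iff.2 fun h => he ?_)
  rw [h, ite_self]

theorem exists_res {U : Set (σ →₀ ℕ)} (hU : IsUpperSet U) {d : ℕ} (h : RegU K d U) :
    ∃ F : GradedFreeResolution (MI K U), ∀ i k, F.deg (i + 1) k ≤ d + i := by
  obtain ⟨s, h0, h1⟩ := h
  have hGR : ∀ i, GR (s i) := by
    intro i
    cases i with
    | zero => rw [h0]; exact GR_MI hU
    | succ i => exact GR_gen (h1 i)
  choose g a1 a2 a3 using h1
  let e : ∀ i, Fin (Fintype.card (s i).ι) ≃ (s i).ι := fun i => (Fintype.equivFin _).symm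
  let mat : (i : ℕ) → Matrix (Fin (Fintype.card (s i).ι)) (Fin (Fintype.card (s (i + 1)).ι))
    (MvPolynomial σ K) := fun i k j => g i (e (i + 1) j) (e i k)
  have hmat : ∀ i c, Matrix.mulVecLin (mat i) c = lc (g i) (c ∘ (e (i + 1)).symm) ∘ e i := by
    intro i c
    funext k
    rw [Function.comp_apply, lc_apply, Matrix.mulVecLin_apply, Matrix.mulVec, dotProduct,
      ← (e (i + 1)).sum_comp]
    refine Finset.sum_congr rfl fun j _ => ?_
    simp [mat, mul_comm]
  have hrange : ∀ i x, x ∈ LinearMap.range (Matrix.mulVecLin (mat i)) ↔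
      x ∘ (e i).symm ∈ (s i).N := by
    intro i x
    constructor
    · rintro ⟨c, rfl⟩
      rw [hmat]
      have : (lc (g i) (c ∘ (e (i + 1)).symm) ∘ e i) ∘ (e i).symm =
        lc (g i) (c ∘ (e (i + 1)).symm) := by funext; simp
      rw [this]
      exact lc_mem (fun j => (a1 i j).1) _
    · intro hx
      obtain ⟨c, hc⟩ := range_of_GR (hGR i) (a2 i) hx
      refine ⟨c ∘ e (i + 1), ?_⟩
      rw [hmat]
      have : (c ∘ e (i + 1)) ∘ (e (i + 1)).symm = c := by funext; simp
      rw [this, hc]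
      funext; simp
  refine ⟨⟨fun i => Fintype.card (s i).ι, fun i k => (s i).dg (e i k), ?_, ?_, mat, ?_, ?_, ?_⟩,
    fun i k => (a1 i (e (i + 1) k)).2.2⟩
  · rw [h0]; rfl
  · intro k
    generalize e 0 k = k'
    revert k'
    rw [h0]
    intro k'
    rfl
  · intro i k j
    exact (a1 i (e (i + 1) j)).2.1 (e i k)
  · intro f
    rw [hrange]
    have : ((fun _ => f : Fin (Fintype.card (s 0).ι) → MvPolynomial σ K)) ∘ (e 0).symm =
      fun _ => f := rfl
    rw [this]
    clear this
    rw [h0]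
    exact Iff.rfl
  · intro i
    ext x
    rw [hrange, LinearMap.mem_ker, hmat, a3, LinearMap.mem_ker]
    constructor
    · intro h
      funext j
      have := congrFun h ((e i).symm j)
      simpa using this
    · intro h
      rw [h]
      rfl

theorem regQuot_le {U : Set (σ →₀ ℕ)} (hU : IsUpperSet U) {d : ℕ} (h : RegU K (d + 1) U) :
    regQuot (MI K U) ≤ ((d : ℤ) : WithBot ℤ) := by
  unfold regQuot
  split_ifs with ht
  · exact bot_le
  · rw [WithBot.coe_le_coe]
    obtain ⟨F, hF⟩ := exists_res hU h
    refine csInf_le ⟨0, ?_⟩ ⟨F, ?_⟩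
    · rintro d ⟨F, hF⟩
      have hpos : 0 < F.rank 0 := by rw [F.rank_zero]; exact one_pos
      have := hF 0 ⟨0, hpos⟩
      rw [F.deg_zero] at this
      simpa using this
    · intro i k
      cases i with
      | zero => rw [F.deg_zero]; simp
      | succ i =>
        have := hF i k
        push_cast
        omega

end res
end RegAux

namespace RegAux
open EdgeIdealReg

/-! ## Part 4: symbolic powers of edge ideals -/

/-- Vertex covers. -/
def Cov {V : Type} (G : SimpleGraph V) (D : Finset V) : Prop := ∀ u v, G.Adj u v → u ∈ D ∨ v ∈ D

/-- Exponents of the symbolic power. -/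
def US {V : Type} (G : SimpleGraph V) (r : ℕ) : Set (V →₀ ℕ) :=
  {b | ∀ D, Cov G D → r ≤ ∑ v ∈ D, b v}

theorem upper_US {V : Type} (G : SimpleGraph V) (r : ℕ) : IsUpperSet (US G r) := by
  intro a b hab ha D hD
  exact (ha D hD).trans (Finset.sum_le_sum fun v _ => hab v)

section symb
variable {V K : Type} [Field K] [DecidableEq V]

/-- Setting the variables in `C` to zero. -/
def rho (C : Finset V) : MvPolynomial V K →ₐ[K] MvPolynomial V K :=
  aeval (fun v => if v ∈ C then 0 else X v)

theorem ker_rho_le {C : Finset V} {q : Ideal (MvPolynomial V K)} (h : ∀ v ∈ C, X v ∈ q) :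
    RingHom.ker (rho (K := K) C) ≤ q := by
  have key : ((Ideal.Quotient.mkₐ K q).comp (rho C)) = Ideal.Quotient.mkₐ K q := by
    apply MvPolynomial.algHom_ext
    intro v
    simp only [rho, AlgHom.comp_apply, aeval_X]
    split_ifs with hv
    · rw [map_zero]
      exact (Ideal.Quotient.eq_zero_iff_mem.2 (h v hv)).symm
    · rfl
  intro f hf
  rw [RingHom.mem_ker] at hf
  have := AlgHom.congr_fun key f
  rw [AlgHom.comp_apply, hf, map_zero] at this
  exact Ideal.Quotient.eq_zero_iff_mem.1 this.symm

theorem X_mem_ker_rho {C : Finset V} {v : V} :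
    X v ∈ RingHom.ker (rho (K := K) C) ↔ v ∈ C := by
  rw [RingHom.mem_ker, rho, aeval_X]
  split_ifs with h <;> simp [h]

theorem edge_le_ker {G : SimpleGraph V} {C : Finset V} (hC : Cov G C) :
    edgeIdeal K G ≤ RingHom.ker (rho (K := K) C) := by
  rw [edgeIdeal, Ideal.span_le]
  rintro p ⟨u, v, huv, rfl⟩
  rcases hC u v huv with h | h
  · exact Ideal.mul_mem_right _ _ (X_mem_ker_rho.2 h)
  · exact Ideal.mul_mem_left _ _ (X_mem_ker_rho.2 h)

/-- weighting the variables in `C`. -/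
def phi (C : Finset V) : MvPolynomial V K →ₐ[K] Polynomial (MvPolynomial V K) :=
  aeval (fun v => if v ∈ C then Polynomial.X * Polynomial.C (X v) else Polynomial.C (X v))

theorem phi_monomial (C : Finset V) (e : V →₀ ℕ) (c : K) :
    phi C (monomial e c) = Polynomial.monomial (∑ v ∈ C, e v) (monomial e c) := by
  rw [phi, aeval_monomial]
  have h1 : (e.prod fun i k => (if i ∈ C then Polynomial.X * Polynomial.C (X i : MvPolynomial V K)
      else Polynomial.C (X i)) ^ k) =
      (e.prod fun i k => (if i ∈ C then (Polynomial.X : Polynomial (MvPolynomial V K)) else 1) ^ k)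
      * Polynomial.C (e.prod fun i k => X i ^ k) := by
    rw [Finsupp.prod, Finsupp.prod, Finsupp.prod, map_prod, ← Finset.prod_mul_distrib]
    refine Finset.prod_congr rfl fun i _ => ?_
    split_ifs
    · rw [mul_pow, map_pow]
    · rw [one_pow, one_mul, map_pow]
  have h2 : (e.prod fun i k => (if i ∈ C then (Polynomial.X : Polynomial (MvPolynomial V K))
      else 1) ^ k) = Polynomial.X ^ (∑ v ∈ C, e v) := by
    rw [← Finset.prod_pow_eq_pow_sum, Finsupp.prod_of_support_subset (s := e.support ∪ C) e
      Finset.subset_union_left _ (fun i _ => pow_zero _),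
      ← Finset.prod_subset (Finset.subset_union_right (s₁ := e.support) (s₂ := C))]
    · exact Finset.prod_congr rfl fun i hi => by rw [if_pos hi]
    · intro i _ hi
      rw [if_neg hi, one_pow]
  rw [h1, h2, ← Polynomial.C_mul_X_pow_eq_monomial, monomial_eq (s := e), map_mul]
  rw [IsScalarTower.algebraMap_apply K (MvPolynomial V K) (Polynomial (MvPolynomial V K))]
  simp only [MvPolynomial.algebraMap_eq, Polynomial.algebraMap_eq]
  ring

theorem coeff_phi (C : Finset V) (f : MvPolynomial V K) (k : ℕ) (e : V →₀ ℕ) :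
    coeff e ((phi C f).coeff k) = if ∑ v ∈ C, e v = k then coeff e f else 0 := by
  classical
  induction f using MvPolynomial.induction_on' with
  | monomial u a =>
    rw [phi_monomial, Polynomial.coeff_monomial, coeff_monomial]
    by_cases h : u = e
    · subst h
      split_ifs <;> simp_all
    · rw [if_neg h]
      split_ifs <;> simp [h]
  | add p q hp hq =>
    rw [map_add, Polynomial.coeff_add, coeff_add, hp, hq, coeff_add]
    split_ifs <;> simp

theorem coeff_zero_phi (C : Finset V) (f : MvPolynomial V K) :
    (phi C f).coeff 0 = rho C f := by
  have : (Polynomial.constantCoeff).comp (phi (K := K) C).toRingHom = (rho C).toRingHom := by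
    apply MvPolynomial.ringHom_ext
    · intro r
      simp [phi, rho, IsScalarTower.algebraMap_apply K (MvPolynomial V K)
        (Polynomial (MvPolynomial V K)), MvPolynomial.algebraMap_eq]
    · intro i
      simp only [phi, rho, RingHom.comp_apply, AlgHom.toRingHom_eq_coe, RingHom.coe_coe, aeval_X]
      split_ifs <;> simp
  exact RingHom.congr_fun this f

theorem exists_min_cov {G : SimpleGraph V} {C : Finset V} (hC : Cov G C) :
    ∃ C' ⊆ C, Cov G C' ∧ ∀ v ∈ C', ∃ w, G.Adj v w ∧ w ∉ C' := by
  induction C using Finset.strongInduction with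
  | H C ih =>
    by_cases h : ∀ v ∈ C, ∃ w, G.Adj v w ∧ w ∉ C
    · exact ⟨C, subset_rfl, hC, h⟩
    · push Not at h
      obtain ⟨v, hv, h⟩ := h
      obtain ⟨C', h1, h2⟩ := ih (C.erase v) (Finset.erase_ssubset hv) (by
        intro a b hab
        simp only [Finset.mem_erase]
        by_cases ha : a = v
        · subst ha
          exact Or.inr ⟨hab.ne', h b hab⟩
        · by_cases hb : b = v
          · subst hb
            exact Or.inl ⟨ha, h a hab.symm⟩
          · rcases hC a b hab with h | h
            · exact Or.inl ⟨ha, h⟩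
            · exact Or.inr ⟨hb, h⟩)
      exact ⟨C', h1.trans (Finset.erase_subset _ _), h2⟩

theorem ker_rho_minimal {G : SimpleGraph V} {C : Finset V} (hC : Cov G C)
    (hmin : ∀ v ∈ C, ∃ w, G.Adj v w ∧ w ∉ C) :
    RingHom.ker (rho (K := K) C) ∈ (edgeIdeal K G).minimalPrimes := by
  refine ⟨⟨RingHom.ker_isPrime _, edge_le_ker hC⟩, ?_⟩
  rintro q ⟨hq, hIq⟩ hqle
  refine ker_rho_le fun v hv => ?_
  obtain ⟨w, hvw, hw⟩ := hmin v hv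
  have h1 : X v * X w ∈ q := hIq (Ideal.subset_span ⟨v, w, hvw, rfl⟩)
  rcases hq.mem_or_mem h1 with h | h
  · exact h
  · exact absurd (X_mem_ker_rho.1 (hqle h)) hw

theorem symb_le {G : SimpleGraph V} (r : ℕ) :
    symbolicPower (edgeIdeal K G) r ≤ MI K (US G r) := by
  intro f hf
  rw [mem_MI (upper_US G r)]
  intro e he C hC
  obtain ⟨C', hsub, hC', hmin⟩ := exists_min_cov hC
  refine le_trans ?_ (Finset.sum_le_sum_of_subset hsub)
  obtain ⟨s, hs, hsf⟩ := hf _ (ker_rho_minimal (K := K) hC' hmin)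
  have hI : edgeIdeal K G ≤ Ideal.comap (phi C') (Ideal.span {Polynomial.X}) := by
    rw [edgeIdeal, Ideal.span_le]
    rintro p ⟨u, v, huv, rfl⟩
    show phi C' (X u * X v) ∈ Ideal.span {Polynomial.X}
    rw [Ideal.mem_span_singleton, map_mul]
    rcases hC' u v huv with h | h
    · refine Dvd.dvd.mul_right ?_ _
      rw [phi, aeval_X, if_pos h]
      exact dvd_mul_right _ _
    · refine Dvd.dvd.mul_left ?_ _
      rw [phi, aeval_X, if_pos h]
      exact dvd_mul_right _ _
  have h1 : phi C' (s * f) ∈ Ideal.span {Polynomial.X ^ r} := by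
    rw [← Ideal.span_singleton_pow]
    have h2 := Ideal.pow_right_mono hI r hsf
    have h3 := Ideal.le_comap_pow (phi C').toRingHom (K := Ideal.span {Polynomial.X}) r h2
    exact h3
  rw [Ideal.mem_span_singleton, map_mul] at h1
  have h2 : ¬ Polynomial.X ∣ phi C' s := by
    rw [Polynomial.X_dvd_iff, coeff_zero_phi]
    exact hs
  have h3 := Polynomial.prime_X.pow_dvd_of_dvd_mul_left r h2 h1
  rw [Polynomial.X_pow_dvd_iff] at h3
  by_contra hlt
  push Not at hlt
  have h4 := h3 _ hlt
  have h5 := coeff_phi C' f (∑ v ∈ C', e v) e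
  rw [h4, if_pos rfl, coeff_zero] at h5
  exact mem_support_iff.1 he h5.symm

theorem le_symb [Fintype V] {G : SimpleGraph V} (r : ℕ) :
    MI K (US G r) ≤ symbolicPower (edgeIdeal K G) r := by
  classical
  rw [MI, Ideal.span_le]
  rintro _ ⟨b, hb, rfl⟩ p hp
  have hpp : p.IsPrime := hp.1.1
  let C : Finset V := Finset.univ.filter fun v => (X v : MvPolynomial V K) ∈ p
  have memC : ∀ v, v ∈ C ↔ (X v : MvPolynomial V K) ∈ p := fun v => by simp [C]
  have hC : Cov G C := by
    intro u v huv
    rw [memC, memC]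
    exact hpp.mem_or_mem (hp.1.2 (Ideal.subset_span ⟨u, v, huv, rfl⟩))
  have hmin : ∀ v ∈ C, ∃ w, G.Adj v w ∧ w ∉ C := by
    obtain ⟨C', h1, h2, h3⟩ := exists_min_cov hC
    have : p ≤ RingHom.ker (rho (K := K) C') :=
      hp.2 ⟨RingHom.ker_isPrime _, edge_le_ker h2⟩
        (ker_rho_le fun v hv => (memC v).1 (h1 hv))
    have h4 : C = C' := by
      refine Finset.Subset.antisymm (fun v hv => ?_) h1
      exact X_mem_ker_rho.1 (this ((memC v).1 hv))
    rw [h4]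
    exact h3
  choose! w hw1 hw2 using hmin
  refine ⟨∏ v ∈ C, X (w v) ^ b v, ?_, ?_⟩
  · rw [hpp.prod_mem_iff]
    rintro ⟨v, hv, h⟩
    exact hw2 v hv ((memC _).2 (hpp.mem_of_pow_mem _ h))
  · show (∏ v ∈ C, X (w v) ^ b v) * monomial b (1 : K) ∈ _
    have h1 : monomial b (1 : K) = (∏ v ∈ C, X v ^ b v) * ∏ v ∈ Cᶜ, X v ^ b v := by
      rw [Finset.prod_mul_prod_compl, monomial_eq, C_1, one_mul,
        Finsupp.prod_fintype _ _ (fun i => pow_zero _)]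
    rw [h1, ← mul_assoc, ← Finset.prod_mul_distrib]
    refine Ideal.mul_mem_right _ _ (Ideal.pow_le_pow_right (hb C hC) ?_)
    rw [← Finset.prod_pow_eq_pow_sum]
    refine Ideal.prod_mem_prod fun v hv => ?_
    rw [← mul_pow]
    have h2 : X (w v) * X v ∈ edgeIdeal K G :=
      Ideal.subset_span ⟨v, w v, hw1 v hv, mul_comm _ _⟩
    exact Ideal.pow_mem_pow h2 _

theorem symb_eq [Fintype V] (G : SimpleGraph V) (r : ℕ) :
    symbolicPower (edgeIdeal K G) r = MI K (US G r) :=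
  le_antisymm (symb_le r) (le_symb r)

end symb
end RegAux

namespace RegAux
open EdgeIdealReg

/-! ## Part 5: chordal graphs -/
section chordal
variable {V : Type}

/-- Chordality of the induced subgraph on `U`. -/
def ChordalOn (Q : SimpleGraph V) (U : Set V) : Prop :=
  ∀ n, 4 ≤ n → ¬ ∃ f : ZMod n → V, Function.Injective f ∧ (∀ i, f i ∈ U) ∧
    ∀ i j : ZMod n, Q.Adj (f i) (f j) ↔ (j = i + 1 ∨ i = j + 1)

theorem ChordalOn.mono {Q : SimpleGraph V} {U U' : Set V} (h : ChordalOn Q U) (hU : U' ⊆ U) :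
    ChordalOn Q U' := by
  rintro n hn ⟨f, h1, h2, h3⟩
  exact h n hn ⟨f, h1, fun i => hU (h2 i), h3⟩

theorem zmod_succ_iff {n : ℕ} (i j : ZMod (n + 2)) :
    j = i + 1 ↔ (j.val = i.val + 1 ∨ (j.val = 0 ∧ i.val = n + 1)) := by
  have hi := ZMod.val_lt i
  have hj := ZMod.val_lt j
  have h1 : (1 : ZMod (n + 2)).val = 1 := by
    rw [ZMod.val_one_eq_one_mod, Nat.mod_eq_of_lt (by omega)]
  have hv : (i + 1).val = (i.val + 1) % (n + 2) := by rw [ZMod.val_add, h1]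
  rw [← (ZMod.val_injective (n + 2)).eq_iff, hv]
  by_cases h : i.val + 1 < n + 2
  · rw [Nat.mod_eq_of_lt h]; omega
  · have h2 : i.val + 1 = n + 2 := by omega
    rw [h2, Nat.mod_self]; omega

/-- Building an induced cycle from an induced path and a vertex adjacent to its two ends. -/
theorem cycle_of_path {Q : SimpleGraph V} {U : Set V} {v : V} {k : ℕ} (hk : 2 ≤ k) (p : ℕ → V)
    (hU : ∀ i ≤ k, p i ∈ U) (hv : v ∈ U) (hinj : ∀ i ≤ k, ∀ j ≤ k, p i = p j → i = j)
    (hadj : ∀ i ≤ k, ∀ j ≤ k, Q.Adj (p i) (p j) ↔ (j = i + 1 ∨ i = j + 1))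
    (hvp : ∀ i ≤ k, v ≠ p i) (hva : ∀ i ≤ k, Q.Adj v (p i) ↔ (i = 0 ∨ i = k)) :
    ¬ ChordalOn Q U := by
  intro h
  refine h (k + 2) (by omega) ⟨fun i => if i.val ≤ k then p i.val else v, ?_, ?_, ?_⟩
  · intro i j hij
    apply ZMod.val_injective
    have hi := ZMod.val_lt i
    have hj := ZMod.val_lt j
    simp only at hij
    split_ifs at hij with h1 h2 h2
    · exact hinj _ h1 _ h2 hij
    · exact absurd hij.symm (hvp _ h1)
    · exact absurd hij (hvp _ h2)
    · omega
  · intro i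
    simp only
    split_ifs with h1
    · exact hU _ h1
    · exact hv
  · intro i j
    have hi := ZMod.val_lt i
    have hj := ZMod.val_lt j
    rw [zmod_succ_iff, zmod_succ_iff]
    simp only
    split_ifs with h1 h2 h2
    · rw [hadj _ h1 _ h2]; omega
    · rw [Q.adj_comm, hva _ h1]; omega
    · rw [hva _ h2]; omega
    · simp only [SimpleGraph.irrefl, false_iff]; omega

/-- A geodesic. -/
theorem exists_geodesic {Q : SimpleGraph V} {s t : V} (h : Q.Reachable s t) :
    ∃ p : ℕ → V, p 0 = s ∧ p (Q.dist s t) = t ∧ (∀ i ≤ Q.dist s t, Q.Reachable s (p i) ∧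
      Q.dist s (p i) = i) ∧ ∀ i < Q.dist s t, Q.Adj (p i) (p (i + 1)) := by
  obtain ⟨w, hw⟩ := h.exists_walk_length_eq_dist
  refine ⟨w.getVert, w.getVert_zero, by rw [← hw, w.getVert_length], ?_, ?_⟩
  · intro i hi
    have h1 : Q.dist s (w.getVert i) ≤ i := by
      refine (SimpleGraph.dist_le (w.take i)).trans ?_
      rw [SimpleGraph.Walk.take_length]
      exact min_le_left _ _
    have h2 : Q.dist (w.getVert i) t ≤ Q.dist s t - i := by
      refine (SimpleGraph.dist_le (w.drop i)).trans ?_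
      rw [SimpleGraph.Walk.drop_length, hw]
    have hr : Q.Reachable s (w.getVert i) := (w.take i).reachable
    have h3 : Q.dist s t ≤ Q.dist s (w.getVert i) + Q.dist (w.getVert i) t := by
      obtain ⟨w1, hw1⟩ := hr.exists_walk_length_eq_dist
      obtain ⟨w2, hw2⟩ := (w.drop i).reachable.exists_walk_length_eq_dist
      rw [← hw1, ← hw2, ← SimpleGraph.Walk.length_append]
      exact SimpleGraph.dist_le _
    exact ⟨hr, by omega⟩
  · intro i hi
    exact w.adj_getVert_succ (by omega)

/-- Simplicial vertex in the induced subgraph on `U`. -/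
def Simp (Q : SimpleGraph V) (U : Set V) (z : V) : Prop :=
  ∀ x ∈ U, ∀ y ∈ U, Q.Adj z x → Q.Adj z y → x ≠ y → Q.Adj x y

/-- The separator is a clique. -/
theorem sep_clique {Q : SimpleGraph V} {U : Set V} (hQ : ChordalOn Q U) {v : V} (hv : v ∈ U)
    {C : Set V} (hCU : C ⊆ U) (hCv : ∀ c ∈ C, c ≠ v ∧ ¬ Q.Adj v c) {c0 : V}
    (hC : ∀ c ∈ C, Relation.ReflTransGen (fun x y => Q.Adj x y ∧ x ∈ C ∧ y ∈ C) c0 c)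
    {s t : V} (hs : s ∈ U) (ht : t ∈ U) (hvs : Q.Adj v s) (hvt : Q.Adj v t) (hst : s ≠ t)
    (hsC : ∃ c ∈ C, Q.Adj s c) (htC : ∃ c ∈ C, Q.Adj t c) : Q.Adj s t := by
  by_contra hnst
  let Q' : SimpleGraph V :=
    { Adj := fun x y => Q.Adj x y ∧ (x ∈ C ∨ x = s ∨ x = t) ∧ (y ∈ C ∨ y = s ∨ y = t)
      symm := ⟨fun x y h => ⟨h.1.symm, h.2.2, h.2.1⟩⟩
      loopless := ⟨fun x h => Q.irrefl h.1⟩ }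
  have hQ' : ∀ x y, Q'.Adj x y ↔ Q.Adj x y ∧ (x ∈ C ∨ x = s ∨ x = t) ∧ (y ∈ C ∨ y = s ∨ y = t) :=
    fun _ _ => Iff.rfl
  have hreachC : ∀ c ∈ C, Q'.Reachable c0 c := by
    intro c hc
    have := hC c hc
    rw [SimpleGraph.reachable_iff_reflTransGen]
    exact Relation.ReflTransGen.lift id (p := Q'.Adj)
      (fun x y h => ⟨h.1, Or.inl h.2.1, Or.inl h.2.2⟩) _ _ this
  obtain ⟨c1, hc1, h1⟩ := hsC
  obtain ⟨c2, hc2, h2⟩ := htC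
  have hr1 : Q'.Reachable s c1 :=
    SimpleGraph.Adj.reachable ⟨h1, Or.inr (Or.inl rfl), Or.inl hc1⟩
  have hr2 : Q'.Reachable t c2 :=
    SimpleGraph.Adj.reachable ⟨h2, Or.inr (Or.inr rfl), Or.inl hc2⟩
  have hr : Q'.Reachable s t :=
    (hr1.trans (hreachC c1 hc1).symm).trans ((hreachC c2 hc2).trans hr2.symm)
  obtain ⟨p, p0, pk, hp, hpa⟩ := exists_geodesic hr
  set k := Q'.dist s t with hk
  have hk0 : k ≠ 0 := by
    intro h0
    rw [h0, p0] at pk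
    exact hst pk
  have hk1 : k ≠ 1 := by
    intro h0
    have := hpa 0 (by omega)
    rw [p0] at this
    rw [h0] at pk
    rw [zero_add, pk] at this
    exact hnst this.1
  have hmem : ∀ i ≤ k, p i ∈ C ∨ p i = s ∨ p i = t := by
    intro i hi
    by_cases hik : i < k
    · exact (hpa i hik).2.1
    · have : i = k := by omega
      rw [this, pk]; exact Or.inr (Or.inr rfl)
  have hinj : ∀ i ≤ k, ∀ j ≤ k, p i = p j → i = j := by
    intro i hi j hj h
    have h1 := (hp i hi).2
    rw [h, (hp j hj).2] at h1
    exact h1.symm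
  have hmid : ∀ i ≤ k, i ≠ 0 → i ≠ k → p i ∈ C := by
    intro i hi h0 hk
    rcases hmem i hi with h | h | h
    · exact h
    · exact absurd (hinj i hi 0 (by omega) (by rw [h, p0])) h0
    · exact absurd (hinj i hi k le_rfl (by rw [h, pk])) hk
  have haux : ∀ i ≤ k, ∀ j ≤ k, Q.Adj (p i) (p j) → j ≤ i + 1 := by
    intro i hi j hj h
    have h3 : Q'.Adj (p i) (p j) := ⟨h, hmem i hi, hmem j hj⟩
    obtain ⟨w, hw⟩ := (hp i hi).1.exists_walk_length_eq_dist
    have h4 := SimpleGraph.dist_le (w.concat h3)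
    rw [SimpleGraph.Walk.length_concat, hw, (hp i hi).2, (hp j hj).2] at h4
    exact h4
  have hU : ∀ i ≤ k, p i ∈ U := by
    intro i hi
    rcases hmem i hi with h | h | h
    · exact hCU h
    · rwa [h]
    · rwa [h]
  refine cycle_of_path (v := v) (k := k) (by omega) p hU hv hinj ?_ ?_ ?_ hQ
  · intro i hi j hj
    constructor
    · intro h
      have h1 := haux i hi j hj h
      have h2 := haux j hj i hi h.symm
      have h3 : i ≠ j := fun h' => by rw [h'] at h; exact Q.irrefl h
      omega
    · rintro (h | h)
      · subst h; exact (hpa i (by omega)).1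
      · subst h; exact (hpa j (by omega)).1.symm
  · intro i hi
    rcases hmem i hi with h | h | h
    · exact (hCv _ h).1.symm
    · rw [h]; exact hvs.ne
    · rw [h]; exact hvt.ne
  · intro i hi
    constructor
    · intro h
      by_contra hcon
      push Not at hcon
      exact (hCv _ (hmid i hi hcon.1 hcon.2)).2 h
    · rintro (h | h)
      · rw [h, p0]; exact hvs
      · rw [h, pk]; exact hvt

theorem dirac_aux (Q : SimpleGraph V) (U : Finset V) (hQ : ChordalOn Q U) (v : V) (hv : v ∈ U)
    (hw : ∃ w ∈ U, w ≠ v ∧ ¬ Q.Adj v w) : ∃ z ∈ U, z ≠ v ∧ ¬ Q.Adj v z ∧ Simp Q U z := by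
  classical
  induction U using Finset.strongInduction generalizing v with
  | H U ih =>
  obtain ⟨c0, hc0U, hc0v, hc0⟩ := hw
  let R : V → V → Prop := fun x y => Q.Adj x y ∧ y ∈ U ∧ y ≠ v ∧ ¬ Q.Adj v y
  let C : Finset V := U.filter fun x => Relation.ReflTransGen R c0 x
  have c0C : c0 ∈ C := Finset.mem_filter.2 ⟨hc0U, Relation.ReflTransGen.refl⟩
  have hCv : ∀ c ∈ C, c ≠ v ∧ ¬ Q.Adj v c := by
    intro c hc
    obtain ⟨_, h⟩ := Finset.mem_filter.1 hc
    cases h with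
    | refl => exact ⟨hc0v, hc0⟩
    | tail _ h => exact h.2.2
  have hCstep : ∀ c ∈ C, ∀ x ∈ U, Q.Adj c x → x ≠ v → ¬ Q.Adj v x → x ∈ C := by
    intro c hc x hx h1 h2 h3
    exact Finset.mem_filter.2 ⟨hx, (Finset.mem_filter.1 hc).2.tail ⟨h1, hx, h2, h3⟩⟩
  have hCR : ∀ c ∈ (C : Set V),
      Relation.ReflTransGen (fun x y => Q.Adj x y ∧ x ∈ (C : Set V) ∧ y ∈ (C : Set V)) c0 c := by
    intro c hc
    have h := (Finset.mem_filter.1 hc).2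
    clear hc
    induction h with
    | refl => exact Relation.ReflTransGen.refl
    | @tail b c h1 h2 ih =>
      have hb : b ∈ C := by
        refine Finset.mem_filter.2 ⟨?_, h1⟩
        cases h1 with
        | refl => exact hc0U
        | tail _ h => exact h.2.1
      exact ih.tail ⟨h2.1, hb, hCstep b hb c h2.2.1 h2.1 h2.2.2.1 h2.2.2.2⟩
  let S : Finset V := U.filter fun x => Q.Adj v x ∧ ∃ c ∈ C, Q.Adj x c
  have hS : ∀ s ∈ S, ∀ t ∈ S, s ≠ t → Q.Adj s t := by
    intro s hs t ht hst
    obtain ⟨hsU, hvs, hsC⟩ := Finset.mem_filter.1 hs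
    obtain ⟨htU, hvt, htC⟩ := Finset.mem_filter.1 ht
    exact sep_clique hQ (C := (C : Set V)) hv
      (fun x hx => (Finset.mem_filter.1 hx).1) hCv hCR hsU htU hvs hvt hst hsC htC
  have hsub : C ∪ S ⊂ U := by
    rw [Finset.ssubset_iff_of_subset]
    · refine ⟨v, hv, fun h => ?_⟩
      rcases Finset.mem_union.1 h with h | h
      · exact (hCv v h).1 rfl
      · exact Q.irrefl (Finset.mem_filter.1 h).2.1
    · intro x hx
      rcases Finset.mem_union.1 hx with h | h
      · exact (Finset.mem_filter.1 h).1
      · exact (Finset.mem_filter.1 h).1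
  have hQ' : ChordalOn Q ((C ∪ S : Finset V) : Set V) := hQ.mono (by exact_mod_cast hsub.1)
  have ih' := ih _ hsub hQ'
  suffices h : ∃ z ∈ C, Simp Q ((C ∪ S : Finset V) : Set V) z by
    obtain ⟨z, hz, hzs⟩ := h
    refine ⟨z, (Finset.mem_filter.1 hz).1, (hCv z hz).1, (hCv z hz).2, ?_⟩
    have key : ∀ x ∈ U, Q.Adj z x → x ∈ ((C ∪ S : Finset V) : Set V) := by
      intro x hx hzx
      rw [Finset.mem_coe, Finset.mem_union]
      by_cases h1 : x = v
      · exact absurd (h1 ▸ hzx).symm (hCv z hz).2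
      · by_cases h2 : Q.Adj v x
        · exact Or.inr (Finset.mem_filter.2 ⟨hx, h2, z, hz, hzx.symm⟩)
        · exact Or.inl (hCstep z hz x hx hzx h1 h2)
    intro x hx y hy hzx hzy hxy
    exact hzs x (key x hx hzx) y (key y hy hzy) hzx hzy hxy
  by_cases hA : ∃ s ∈ S, ∃ w ∈ C ∪ S, w ≠ s ∧ ¬ Q.Adj s w
  · obtain ⟨s, hs, hw⟩ := hA
    obtain ⟨z, hz, hzs, hsz, hzz⟩ := ih' s (Finset.mem_union_right _ hs) hw
    rcases Finset.mem_union.1 hz with h | h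
    · exact ⟨z, h, hzz⟩
    · exact absurd (hS s hs z h hzs.symm) hsz
  · push Not at hA
    by_cases hB : ∃ s ∈ C, ∃ w ∈ C ∪ S, w ≠ s ∧ ¬ Q.Adj s w
    · obtain ⟨s, hs, hw⟩ := hB
      obtain ⟨z, hz, hzs, hsz, hzz⟩ := ih' s (Finset.mem_union_left _ hs) hw
      rcases Finset.mem_union.1 hz with h | h
      · exact ⟨z, h, hzz⟩
      · exact absurd (hA z h s (Finset.mem_union_left _ hs) hzs.symm).symm hsz
    · push Not at hB
      refine ⟨c0, c0C, ?_⟩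
      intro x hx y hy _ _ hxy
      rcases Finset.mem_union.1 (Finset.mem_coe.1 hx) with h | h
      · exact hB x h y hy hxy.symm
      · exact hA x h y hy hxy.symm

theorem dirac (Q : SimpleGraph V) (U : Finset V) (hQ : ChordalOn Q U) (hU : U.Nonempty) :
    ∃ z ∈ U, Simp Q U z := by
  by_cases h : ∃ v ∈ U, ∃ w ∈ U, w ≠ v ∧ ¬ Q.Adj v w
  · obtain ⟨v, hv, hw⟩ := h
    obtain ⟨z, hz, _, _, h⟩ := dirac_aux Q U hQ v hv hw
    exact ⟨z, hz, h⟩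
  · push Not at h
    obtain ⟨v, hv⟩ := hU
    exact ⟨v, hv, fun x hx y hy _ _ hxy => h x hx y hy hxy.symm⟩

end chordal

section woodroofe
variable {V K : Type} [Field K]

/-- Exponents of the ideal generated by the variables in `W` and the edges of the graphs in `Hs`. -/
def LU (W : Set V) (Hs : List (SimpleGraph V)) : Set (V →₀ ℕ) :=
  {e | (∃ w ∈ W, 1 ≤ e w) ∨ ∃ H ∈ Hs, ∃ u v, H.Adj u v ∧ 1 ≤ e u ∧ 1 ≤ e v}

theorem upper_LU (W : Set V) (Hs : List (SimpleGraph V)) : IsUpperSet (LU W Hs) := by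
  rintro a b hab (⟨w, hw, h⟩ | ⟨H, hH, u, v, huv, hu, hv⟩)
  · exact Or.inl ⟨w, hw, h.trans (hab w)⟩
  · exact Or.inr ⟨H, hH, u, v, huv, hu.trans (hab u), hv.trans (hab v)⟩

theorem LU_insert (W : Set V) (Hs : List (SimpleGraph V)) (z : V) :
    LU W Hs ∪ Set.Ici (Finsupp.single z 1) = LU (insert z W) Hs := by
  ext e
  simp only [LU, Set.mem_union, Set.mem_ofPred_eq, Set.mem_Ici, Finsupp.single_le_iff,
    Set.mem_insert_iff, exists_eq_or_imp]
  rw [or_comm, ← or_assoc]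

theorem single_add_ge {z u : V} (h : u ≠ z) (e : V →₀ ℕ) :
    1 ≤ (Finsupp.single z 1 + e : V →₀ ℕ) u ↔ 1 ≤ e u := by
  rw [Finsupp.add_apply, Finsupp.single_eq_of_ne h, zero_add]

theorem degree_single_one (z : V) : (Finsupp.single z 1 : V →₀ ℕ).degree = 1 := by
  simp

theorem regU_vars (W : Finset V) : RegU K 1 (LU (W : Set V) []) := by
  classical
  induction W using Finset.induction_on with
  | empty =>
    have : LU (V := V) ((∅ : Finset V) : Set V) [] = ∅ := by
      ext e; simp [LU]
    rw [this]
    exact regU_empty 1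
  | insert w W hw ih =>
    rw [Finset.coe_insert, ← LU_insert]
    refine regU_cone (upper_LU _ _) _ (dA := 1) ?_ (by simp) ih (by simp)
    have : {e | Finsupp.single w 1 + e ∈ LU (W : Set V) []} = LU (W : Set V) [] := by
      ext e
      simp only [LU, Set.mem_ofPred_eq, List.not_mem_nil, false_and, exists_false, or_false]
      constructor
      · rintro ⟨x, hx, h⟩
        exact ⟨x, hx, (single_add_ge (z := w) (u := x) (fun h => hw (h ▸ hx)) e).1 h⟩
      · rintro ⟨x, hx, h⟩
        exact ⟨x, hx, (single_add_ge (z := w) (u := x) (fun h => hw (h ▸ hx)) e).2 h⟩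
    rw [this]
    exact ih

theorem woodroofe [Fintype V] (Hs : List (SimpleGraph V)) (W : Finset V)
    (h : ∀ H ∈ Hs, ChordalOn Hᶜ ((W : Set V)ᶜ)) :
    RegU K (Hs.length + 1) (LU (W : Set V) Hs) := by
  classical
  induction Hs generalizing W with
  | nil => exact regU_vars W
  | cons H Hs ih =>
    generalize hn : Wᶜ.card = n
    induction n generalizing W with
    | zero =>
      have hW : W = Finset.univ := by
        rwa [Finset.card_eq_zero, Finset.compl_eq_empty_iff] at hn
      have : LU (W : Set V) (H :: Hs) = LU (W : Set V) [] := by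
        ext e
        subst hW
        constructor
        · rintro (h | ⟨_, _, u, _, _, hu, _⟩)
          · exact Or.inl h
          · exact Or.inl ⟨u, by simp, hu⟩
        · rintro (h | ⟨_, h, _⟩)
          · exact Or.inl h
          · simp at h
      rw [this]
      exact (regU_vars W).mono (by omega)
    | succ n ihn =>
      have hne : Wᶜ.Nonempty := by rw [← Finset.card_pos]; omega
      obtain ⟨z, hz, hzs⟩ := dirac Hᶜ Wᶜ (by
        rw [Finset.coe_compl]; exact h H (by simp)) hne
      have hzW : z ∉ W := Finset.mem_compl.1 hz
      let N : Finset V := Finset.univ.filter fun u => ∃ H' ∈ H :: Hs, H'.Adj z u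
      have memN : ∀ u, u ∈ N ↔ ∃ H' ∈ H :: Hs, H'.Adj z u := fun u => by simp [N]
      have hcol : {e | Finsupp.single z 1 + e ∈ LU (W : Set V) (H :: Hs)} =
          LU ((W ∪ N : Finset V) : Set V) Hs := by
        ext e
        constructor
        · rintro (⟨w, hw, h1⟩ | ⟨H', hH', u, v, huv, hu, hv⟩)
          · exact Or.inl ⟨w, by
              rw [Finset.mem_coe, Finset.mem_union]; exact Or.inl hw,
              (single_add_ge (z := z) (u := w) (fun h => hzW (h ▸ hw)) e).1 h1⟩
          · by_cases huz : u = z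
            · subst huz
              exact Or.inl ⟨v, Finset.mem_coe.2 (Finset.mem_union_right _
                ((memN v).2 ⟨H', hH', huv⟩)), (single_add_ge huv.ne' e).1 hv⟩
            by_cases hvz : v = z
            · subst hvz
              exact Or.inl ⟨u, Finset.mem_coe.2 (Finset.mem_union_right _
                ((memN u).2 ⟨H', hH', huv.symm⟩)), (single_add_ge huv.ne e).1 hu⟩
            have hu' := (single_add_ge huz e).1 hu
            have hv' := (single_add_ge hvz e).1 hv
            by_cases huW : u ∈ W ∪ N
            · exact Or.inl ⟨u, huW, hu'⟩
            by_cases hvW : v ∈ W ∪ N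
            · exact Or.inl ⟨v, hvW, hv'⟩
            rw [Finset.mem_union, not_or] at huW hvW
            rcases List.mem_cons.1 hH' with rfl | hH''
            · exfalso
              have := hzs u (by simpa using huW.1) v (by simpa using hvW.1)
                ⟨Ne.symm huz, fun h => huW.2 ((memN u).2 ⟨H', hH', h⟩)⟩
                ⟨Ne.symm hvz, fun h => hvW.2 ((memN v).2 ⟨H', hH', h⟩)⟩ huv.ne
              exact this.2 huv
            · exact Or.inr ⟨H', hH'', u, v, huv, hu', hv'⟩
        · have hle : e ≤ Finsupp.single z 1 + e := le_add_self
          rintro (⟨w, hw, h1⟩ | ⟨H', hH', u, v, huv, hu, hv⟩)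
          · rcases Finset.mem_union.1 (Finset.mem_coe.1 hw) with hw | hw
            · exact Or.inl ⟨w, hw, h1.trans (hle w)⟩
            · obtain ⟨H', hH', hzw⟩ := (memN w).1 hw
              exact Or.inr ⟨H', hH', z, w, hzw, by simp, h1.trans (hle w)⟩
          · exact Or.inr ⟨H', List.mem_cons_of_mem _ hH', u, v, huv, hu.trans (hle u),
              hv.trans (hle v)⟩
      refine regU_step (upper_LU _ _) (Finsupp.single z 1) (dA := Hs.length + 1) ?_ ?_ ?_ ?_
      · rw [hcol]
        refine ih (W ∪ N) fun H' hH' => (h H' (List.mem_cons_of_mem _ hH')).mono ?_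
        rw [Finset.coe_union]
        exact Set.compl_subset_compl.2 Set.subset_union_left
      · simp
      · rw [LU_insert, ← Finset.coe_insert]
        refine ihn (insert z W) (fun H' hH' => (h H' hH').mono ?_) ?_
        · rw [Finset.coe_insert]
          exact Set.compl_subset_compl.2 (Set.subset_insert _ _)
        · rw [Finset.compl_insert, Finset.card_erase_of_mem hz]; omega
      · simp

end woodroofe
end RegAux

namespace RegAux
open EdgeIdealReg
open scoped Classical

variable {V : Type}

/-- Combinatorial content of a clique attachment to a bipartite graph. -/
structure Att (G : SimpleGraph V) (H : Set V) (c : V → Bool) : Prop where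
  twin : ∀ x y z, x ∉ H → y ∉ H → G.Adj x y → z ≠ y → G.Adj x z → G.Adj y z
  uniq : ∀ x, x ∉ H → ∀ h1 ∈ H, ∀ h2 ∈ H, G.Adj x h1 → G.Adj x h2 → h1 = h2
  color : ∀ x, x ∈ H → ∀ y, G.Adj x y → c x ≠ c y

theorem Att.not {G : SimpleGraph V} {H : Set V} {c : V → Bool} (h : Att G H c) :
    Att G H (fun v => !c v) :=
  ⟨h.twin, h.uniq, fun x hx y hy e => h.color x hx y hy (by simpa using e)⟩

theorem att_of {G : SimpleGraph V} {H T : Set V} (A : CliqueAttachment G H T)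
    (hbip : (G.induce H).Colorable 2) : ∃ c, Att G H c := by
  obtain ⟨col⟩ := hbip
  have key : ∀ x, x ∉ H → ∃ i, x ∈ A.C i := by
    intro x hx
    have : x ∈ H ∪ (⋃ i, (A.C i : Set V)) := by rw [A.cover]; trivial
    rcases this with h | h
    · exact absurd h hx
    · simpa using h
  have uni : ∀ x, x ∉ H → ∀ i j, x ∈ A.C i → x ∈ A.C j → i = j := by
    intro x hx i j hi hj
    by_contra hij
    have := A.pairwise_inter i j hij ⟨hi, hj⟩
    rw [Set.mem_singleton_iff] at this
    exact hx (this ▸ A.T_sub (A.a_mem_T i))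
  have adj : ∀ x, x ∉ H → ∀ y, G.Adj x y → ∃ i, x ∈ A.C i ∧ y ∈ A.C i := by
    intro x hx y hy
    rcases A.edges_sub x y hy with h | h
    · exact absurd h.1 hx
    · exact h
  have inH : ∀ i y, y ∈ A.C i → y ∈ H → y = A.a i := by
    intro i y hy hyH
    have : y ∈ (A.C i : Set V) ∩ H := ⟨hy, hyH⟩
    rw [A.inter_H i] at this
    exact this
  have uniq : ∀ x, x ∉ H → ∀ h1 ∈ H, ∀ h2 ∈ H, G.Adj x h1 → G.Adj x h2 → h1 = h2 := by
    intro x hx h1 hh1 h2 hh2 a1 a2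
    obtain ⟨i, xi, hi⟩ := adj x hx h1 a1
    obtain ⟨j, xj, hj⟩ := adj x hx h2 a2
    have := uni x hx i j xi xj
    subst this
    rw [inH i h1 hi hh1, inH i h2 hj hh2]
  let ch : V → Bool := fun v => if h : v ∈ H then decide (col ⟨v, h⟩ = 0) else true
  let c : V → Bool := fun v => if v ∈ H then ch v else
    if h : ∃ y ∈ H, G.Adj v y then !(ch h.choose) else true
  have cH : ∀ v, v ∈ H → c v = ch v := fun v hv => by simp [c, hv]
  have cX : ∀ x, x ∉ H → ∀ y ∈ H, G.Adj x y → c x = !(ch y) := by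
    intro x hx y hy hxy
    have hex : ∃ y ∈ H, G.Adj x y := ⟨y, hy, hxy⟩
    have : hex.choose = y := uniq x hx _ hex.choose_spec.1 y hy hex.choose_spec.2 hxy
    simp only [c, hx, if_false, hex, dif_pos]
    rw [this]
  refine ⟨c, ?_, uniq, ?_⟩
  · intro x y z hx hy hxy hzy hxz
    obtain ⟨i, xi, hi⟩ := adj x hx y hxy
    obtain ⟨j, xj, hj⟩ := adj x hx z hxz
    have := uni x hx i j xi xj
    subst this
    exact A.clique i hi hj (Ne.symm hzy)
  · intro x hx y hxy
    by_cases hy : y ∈ H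
    · rw [cH x hx, cH y hy]
      have hne : col ⟨x, hx⟩ ≠ col ⟨y, hy⟩ := col.valid (by simpa using hxy)
      simp only [ch, hx, hy, dif_pos]
      intro h
      apply hne
      generalize col ⟨x, hx⟩ = a at *
      generalize col ⟨y, hy⟩ = b at *
      revert a b
      decide
    · rw [cH x hx, cX y hy x hx hxy.symm]
      simp

variable [Fintype V]

/-- `mix` of two sets along a colouring. -/
def mix (c : V → Bool) (D E : Finset V) : Finset V :=
  Finset.univ.filter fun v => if c v = true then v ∈ D ∧ v ∈ E else v ∈ D ∨ v ∈ E

def good (c : V → Bool) (v : V) (D : Finset V) : Prop :=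
  if c v = true then v ∉ D else v ∈ D

theorem mem_mix {c : V → Bool} {D E : Finset V} {v : V} :
    v ∈ mix c D E ↔ if c v = true then v ∈ D ∧ v ∈ E else v ∈ D ∨ v ∈ E := by
  simp [mix]

theorem good_mix_left {c : V → Bool} {D E : Finset V} {v : V} (h : good c v D) :
    good c v (mix c D E) := by
  unfold good at *
  rw [mem_mix]
  split_ifs at * <;> tauto

theorem good_mix_right {c : V → Bool} {D E : Finset V} {v : V} (h : good c v E) :
    good c v (mix c D E) := by
  unfold good at *
  rw [mem_mix]
  split_ifs at * <;> tauto

theorem mix_not_mem {c : V → Bool} {D E : Finset V} {v : V} (h : v ∉ D) (h' : v ∉ E) :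
    v ∉ mix c D E := by
  rw [mem_mix]
  split_ifs <;> tauto

theorem mix_mem {c : V → Bool} {D E : Finset V} {v : V} (h : v ∈ D) (h' : v ∈ E) :
    v ∈ mix c D E := by
  rw [mem_mix]
  split_ifs <;> tauto

theorem sum_eq_ite (b : V → ℤ) (D : Finset V) :
    ∑ v ∈ D, b v = ∑ v, if v ∈ D then b v else 0 := by
  rw [← Finset.sum_filter]
  simp

theorem sum_mix (b : V → ℤ) (c : V → Bool) (D E : Finset V) :
    ∑ v ∈ mix c D E, b v + ∑ v ∈ mix (fun v => !c v) D E, b v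
      = ∑ v ∈ D, b v + ∑ v ∈ E, b v := by
  rw [sum_eq_ite, sum_eq_ite b (mix _ D E), sum_eq_ite b D, sum_eq_ite b E,
    ← Finset.sum_add_distrib, ← Finset.sum_add_distrib]
  apply Finset.sum_congr rfl
  intro v _
  simp only [mem_mix]
  cases c v <;> by_cases h1 : v ∈ D <;> by_cases h2 : v ∈ E <;> simp [h1, h2]

theorem fold_mix (c : V → Bool) (L : Finset V → Prop) (hL : ∃ D, L D)
    (hmix : ∀ D E, L D → L E → L (mix c D E)) (s : V → Prop)
    (h : ∀ v, s v → ∃ D, L D ∧ good c v D) : ∃ D, L D ∧ ∀ v, s v → good c v D := by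
  have : ∀ t : Finset V, (∀ v ∈ t, ∃ D, L D ∧ good c v D) → ∃ D, L D ∧ ∀ v ∈ t, good c v D := by
    intro t
    induction t using Finset.induction_on with
    | empty => intro _; obtain ⟨D, hD⟩ := hL; exact ⟨D, hD, by simp⟩
    | insert a t ha ih =>
      intro ht
      obtain ⟨D, hD, hDt⟩ := ih fun v hv => ht v (Finset.mem_insert_of_mem hv)
      obtain ⟨E, hE, hEa⟩ := ht a (Finset.mem_insert_self _ _)
      refine ⟨mix c D E, hmix D E hD hE, fun v hv => ?_⟩
      rcases Finset.mem_insert.1 hv with rfl | hv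
      · exact good_mix_right hEa
      · exact good_mix_left (hDt v hv)
  obtain ⟨D, hD, h'⟩ := this (Finset.univ.filter s) (by simpa using h)
  exact ⟨D, hD, fun v hv => h' v (by simpa using hv)⟩

variable {G : SimpleGraph V} {H : Set V} {c : V → Bool}

/-- `O` is a choice of all-but-one vertex in each attached clique, with score `s`. -/
structure Choice (G : SimpleGraph V) (H : Set V) (s : V → ℤ) (O : Finset V) : Prop where
  out : ∀ x ∈ O, x ∉ H
  pair : ∀ x y, x ∉ H → y ∉ H → G.Adj x y → x ∈ O ∨ y ∈ O
  rep : ∀ x ∈ O, ∃ y, y ∉ H ∧ y ∉ O ∧ G.Adj x y ∧ s x ≤ s y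

theorem exists_choice (hA : Att G H c) (s : V → ℤ) : ∃ O, Choice G H s O := by
  let e := Fintype.equivFin V
  let key : V → ℤ ×ₗ Fin (Fintype.card V) := fun v => toLex (s v, e v)
  have kinj : Function.Injective key := by
    intro a b h
    have := congrArg (fun z => (ofLex z).2) h
    exact e.injective this
  have kle : ∀ a b, key a < key b → s a ≤ s b := by
    intro a b h
    rw [Prod.Lex.lt_iff] at h
    rcases h with h | h
    · exact h.le
    · exact h.1.le
  let O : Finset V := Finset.univ.filter fun x => x ∉ H ∧ ∃ y, y ∉ H ∧ G.Adj x y ∧ key x < key y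
  have mO : ∀ x, x ∈ O ↔ x ∉ H ∧ ∃ y, y ∉ H ∧ G.Adj x y ∧ key x < key y := fun x => by simp [O]
  refine ⟨O, fun x hx => ((mO x).1 hx).1, ?_, ?_⟩
  · intro x y hx hy hxy
    rcases lt_trichotomy (key x) (key y) with h | h | h
    · exact Or.inl ((mO x).2 ⟨hx, y, hy, hxy, h⟩)
    · exact absurd (kinj h) hxy.ne
    · exact Or.inr ((mO y).2 ⟨hy, x, hx, hxy.symm, h⟩)
  · intro x hx
    obtain ⟨hxH, y0, hy0, hxy0, hlt⟩ := (mO x).1 hx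
    obtain ⟨y, hy, hmax⟩ := Finset.exists_max_image
      (Finset.univ.filter fun y => y ∉ H ∧ G.Adj x y) key ⟨y0, by simp [hy0, hxy0]⟩
    simp only [Finset.mem_filter, Finset.mem_univ, true_and] at hy hmax
    have hxy : key x < key y := hlt.trans_le (hmax y0 ⟨hy0, hxy0⟩)
    refine ⟨y, hy.1, ?_, hy.2, kle _ _ hxy⟩
    intro hyO
    obtain ⟨_, z, hz, hyz, hl⟩ := (mO y).1 hyO
    by_cases hzx : z = x
    · subst hzx; exact absurd hl hxy.not_gt
    · exact absurd hl (hmax z ⟨hz, hA.twin y x z hy.1 hxH hy.2.symm hzx hyz⟩).not_gt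

theorem twin_swap (hA : Att G H c) {x y : V} (hx : x ∉ H) (hy : y ∉ H) (hxy : G.Adj x y)
    {D : Finset V} (hD : Cov G D) (hxD : x ∉ D) : Cov G (insert x (D.erase y)) := by
  intro p q hpq
  simp only [Finset.mem_insert, Finset.mem_erase]
  by_contra hcon
  push Not at hcon
  obtain ⟨⟨h1, h2⟩, h3, h4⟩ := hcon
  by_cases hp : p = y
  · subst hp
    have hq := hA.twin p x q hy hx hxy.symm h3 hpq
    rcases hD x q hq with h | h
    · exact hxD h
    · exact h4 hpq.ne' h
  by_cases hq : q = y
  · subst hq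
    have hq := hA.twin q x p hy hx hxy.symm h1 hpq.symm
    rcases hD x p hq with h | h
    · exact hxD h
    · exact h2 hpq.ne h
  rcases hD p q hpq with h | h
  · exact h2 hp h
  · exact h4 hq h

theorem sum_twin_swap (w : V → ℤ) {x y : V} {D : Finset V} (hxD : x ∉ D) (hyD : y ∈ D) :
    ∑ v ∈ insert x (D.erase y), w v = ∑ v ∈ D, w v + w x - w y := by
  rw [Finset.sum_insert (by simp [hxD]), ← Finset.add_sum_erase D w hyD]
  ring

theorem swap_lemma (hA : Att G H c) {s : V → ℤ} {O : Finset V} (hO : Choice G H s O)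
    (w : V → ℤ) (hw : ∀ x ∈ O, ∀ y, y ∉ O → G.Adj x y → y ∉ H → s x ≤ s y → w x ≤ w y)
    (D : Finset V) (hD : Cov G D) :
    ∃ D', Cov G D' ∧ O ⊆ D' ∧ ∑ v ∈ D', w v ≤ ∑ v ∈ D, w v ∧ (∀ z ∈ H, z ∈ D' ↔ z ∈ D) ∧
      ∀ z, z ∉ O → z ∉ D → z ∉ D' := by
  generalize hn : (O \ D).card = n
  induction n using Nat.strong_induction_on generalizing D with
  | _ n ih =>
  by_cases hOD : O ⊆ D
  · exact ⟨D, hD, hOD, le_rfl, fun _ _ => Iff.rfl, fun _ _ h => h⟩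
  obtain ⟨x, hxO, hxD⟩ := Finset.not_subset.1 hOD
  obtain ⟨y, hyH, hyO, hxy, hs⟩ := hO.rep x hxO
  have hyD : y ∈ D := (hD x y hxy).resolve_left hxD
  have hxH := hO.out x hxO
  obtain ⟨D', h1, h2, h3, h4, h5⟩ := ih (O \ (insert x (D.erase y))).card (by
    rw [← hn]
    apply Finset.card_lt_card
    refine ⟨?_, ?_⟩
    · intro z hz
      simp only [Finset.mem_sdiff, Finset.mem_insert, Finset.mem_erase, not_or] at hz ⊢
      refine ⟨hz.1, fun h => hz.2.2 ⟨?_, h⟩⟩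
      rintro rfl
      exact hyO hz.1
    · intro hsub
      have := hsub (Finset.mem_sdiff.2 ⟨hxO, hxD⟩)
      simp at this) _ (twin_swap hA hxH hyH hxy hD hxD) rfl
  refine ⟨D', h1, h2, h3.trans ?_, ?_, ?_⟩
  · rw [sum_twin_swap w hxD hyD]
    have := hw x hxO y hyO hxy hyH hs
    linarith
  · intro z hz
    rw [h4 z hz]
    have h6 : z ≠ x := fun h => hxH (h ▸ hz)
    have h7 : z ≠ y := fun h => hyH (h ▸ hz)
    simp [h6, h7]
  · intro z hzO hzD
    apply h5 z hzO
    have h6 : z ≠ x := fun h => hzO (h ▸ hxO)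
    simp [h6, hzD]

/-- Minimal covers containing `O`. -/
def MinO (G : SimpleGraph V) (b : V → ℤ) (k : ℤ) (O : Finset V) (D : Finset V) : Prop :=
  Cov G D ∧ O ⊆ D ∧ ∑ v ∈ D, b v ≤ k

theorem mix_cov (hA : Att G H c) {s : V → ℤ} {O : Finset V} (hO : Choice G H s O)
    {D E : Finset V} (hD : Cov G D) (hOD : O ⊆ D) (hE : Cov G E) (hOE : O ⊆ E) :
    Cov G (mix c D E) ∧ O ⊆ mix c D E := by
  have h2 : O ⊆ mix c D E := fun v hv => mix_mem (hOD hv) (hOE hv)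
  refine ⟨?_, h2⟩
  intro p q hpq
  by_contra hcon
  rw [not_or] at hcon
  have hp : p ∉ O := fun h => hcon.1 (h2 h)
  have hq : q ∉ O := fun h => hcon.2 (h2 h)
  have hc : c p ≠ c q := by
    by_cases hpH : p ∈ H
    · exact hA.color p hpH q hpq
    by_cases hqH : q ∈ H
    · exact (hA.color q hqH p hpq.symm).symm
    rcases hO.pair p q hpH hqH hpq with h | h
    · exact absurd h hp
    · exact absurd h hq
  obtain ⟨h3, h4⟩ := hcon
  rw [mem_mix] at h3 h4
  have h5 := hD p q hpq
  have h6 := hE p q hpq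
  cases hcp : c p <;> cases hcq : c q <;> simp only [hcp, hcq] at * <;> simp at * <;> tauto

theorem mix_minO (hA : Att G H c) {s : V → ℤ} {O : Finset V} (hO : Choice G H s O)
    {b : V → ℤ} {k : ℤ} (hk : ∀ D, Cov G D → k ≤ ∑ v ∈ D, b v)
    {D E : Finset V} (hD : MinO G b k O D) (hE : MinO G b k O E) :
    MinO G b k O (mix c D E) := by
  obtain ⟨h1, h2⟩ := mix_cov hA hO hD.1 hD.2.1 hE.1 hE.2.1
  obtain ⟨h3, h4⟩ := mix_cov hA.not hO hD.1 hD.2.1 hE.1 hE.2.1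
  refine ⟨h1, h2, ?_⟩
  have := sum_mix b c D E
  have := hk _ h3
  have := hD.2.2
  have := hE.2.2
  linarith

end RegAux

namespace RegAux
open EdgeIdealReg
open scoped Classical

variable {V : Type} [Fintype V] {G : SimpleGraph V} {H : Set V} {c : V → Bool}

def ind (u : V) (D : Finset V) : ℤ := if u ∈ D then 1 else 0

theorem ind_of_mem {u : V} {D : Finset V} (h : u ∈ D) : ind u D = 1 := if_pos h
theorem ind_of_not_mem {u : V} {D : Finset V} (h : u ∉ D) : ind u D = 0 := if_neg h
theorem ind_nonneg (u : V) (D : Finset V) : 0 ≤ ind u D := by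
  unfold ind; split_ifs <;> simp
theorem ind_le_one (u : V) (D : Finset V) : ind u D ≤ 1 := by
  unfold ind; split_ifs <;> simp
theorem not_mem_of_ind {u : V} {D : Finset V} (h : ind u D ≤ 0) : u ∉ D := by
  intro h'
  rw [ind_of_mem h'] at h
  omega
theorem mem_of_ind {u : V} {D : Finset V} (h : 1 ≤ ind u D) : u ∈ D := by
  by_contra h'
  rw [ind_of_not_mem h'] at h
  omega

/-- The tie-breaking term of the score. -/
def tb (b b' : V → ℤ) (v : V) : ℤ := if b v < b' v then 2 else if b v = b' v then 1 else 0

theorem tb_lt {b b' : V → ℤ} {v : V} (h : b v < b' v) : tb b b' v = 2 := if_pos h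
theorem tb_eq {b b' : V → ℤ} {v : V} (h : b v = b' v) : tb b b' v = 1 := by simp [tb, h]
theorem tb_gt {b b' : V → ℤ} {v : V} (h : b' v < b v) : tb b b' v = 0 := by
  simp [tb, h.not_gt, h.ne']
theorem tb_nonneg (b b' : V → ℤ) (v : V) : 0 ≤ tb b b' v := by
  unfold tb; split_ifs <;> simp
theorem tb_le (b b' : V → ℤ) (v : V) : tb b b' v ≤ 2 := by
  unfold tb; split_ifs <;> simp

/-- Common part: a minimal cover avoiding all `P`-vertices. -/
theorem aug_core (hA : Att G H c) {b b' : V → ℤ} {k : ℤ}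
    (hk : ∀ D, Cov G D → k ≤ ∑ v ∈ D, b v) {u : V} (hu : b u < b' u)
    (hi : ∀ x, b x < b' x → ∃ D, Cov G D ∧ ∑ v ∈ D, b v + ind x D ≤ k)
    (hii : ∀ x y, x ≠ y → b x < b' x → b y < b' y →
      ∃ D, Cov G D ∧ ∑ v ∈ D, b v + ind x D + ind y D ≤ k) :
    ∃ O, Choice G H (fun v => 3 * b v + tb b b' v) O ∧ (∀ x, b x < b' x → x ∉ O) ∧
      (∀ x y, b x < b' x → b y < b' y → ∃ D, MinO G b k O D ∧ x ∉ D ∧ y ∉ D) ∧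
      ∃ D, MinO G b k O D ∧ ∀ x, b x < b' x → x ∉ D := by
  obtain ⟨O, hO⟩ := exists_choice hA (fun v => 3 * b v + tb b b' v)
  have hpair : ∀ x y, b x < b' x → b y < b' y →
      ∃ D, Cov G D ∧ ∑ v ∈ D, b v ≤ k ∧ x ∉ D ∧ y ∉ D := by
    intro x y hx hy
    by_cases hxy : x = y
    · subst hxy
      obtain ⟨D, hD, h⟩ := hi x hx
      have := hk D hD
      have := ind_nonneg x D
      have h1 : x ∉ D := not_mem_of_ind (by linarith)
      exact ⟨D, hD, by linarith, h1, h1⟩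
    · obtain ⟨D, hD, h⟩ := hii x y hxy hx hy
      have := hk D hD
      have := ind_nonneg x D
      have := ind_nonneg y D
      exact ⟨D, hD, by linarith, not_mem_of_ind (by linarith), not_mem_of_ind (by linarith)⟩
  have hPO : ∀ x, b x < b' x → x ∉ O := by
    intro x hx hxO
    obtain ⟨y, hyH, hyO, hxy, hs⟩ := hO.rep x hxO
    simp only [tb_lt hx] at hs
    by_cases hy : b y < b' y
    · obtain ⟨D, hD, _, h1, h2⟩ := hpair x y hx hy
      rcases hD x y hxy with h | h
      · exact h1 h
      · exact h2 h
    · have hy2 : tb b b' y ≤ 1 := by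
        unfold tb; rw [if_neg hy]; split_ifs <;> simp
      obtain ⟨D, hD, hw, h1, _⟩ := hpair x x hx hx
      have hyD : y ∈ D := (hD x y hxy).resolve_left h1
      have h3 := hk _ (twin_swap hA (hO.out x hxO) hyH hxy hD h1)
      rw [sum_twin_swap b h1 hyD] at h3
      omega
  have hpO : ∀ x y, b x < b' x → b y < b' y → ∃ D, MinO G b k O D ∧ x ∉ D ∧ y ∉ D := by
    intro x y hx hy
    obtain ⟨D, hD, hw, h1, h2⟩ := hpair x y hx hy
    obtain ⟨D', h3, h4, h5, _, h6⟩ := swap_lemma hA hO b (by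
      intro x _ y _ _ _ hs
      have := tb_nonneg b b' x
      have := tb_le b b' y
      omega) D hD
    exact ⟨D', ⟨h3, h4, h5.trans hw⟩, h6 x (hPO x hx) h1, h6 y (hPO y hy) h2⟩
  refine ⟨O, hO, hPO, hpO, ?_⟩
  have step1 : ∀ w, b w < b' w → ∃ D, (MinO G b k O D ∧ w ∉ D) ∧
      ∀ x, (b x < b' x ∧ c x = true) → x ∉ D := by
    intro w hw
    obtain ⟨D, hD, hg⟩ := fold_mix c (fun D => MinO G b k O D ∧ w ∉ D) (by
      obtain ⟨D, h1, h2, _⟩ := hpO w w hw hw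
      exact ⟨D, h1, h2⟩)
      (fun D E hD hE => ⟨mix_minO hA hO hk hD.1 hE.1, mix_not_mem hD.2 hE.2⟩)
      (fun x => b x < b' x ∧ c x = true) (by
        rintro x ⟨hx, hcx⟩
        obtain ⟨D, h1, h2, h3⟩ := hpO w x hw hx
        exact ⟨D, ⟨h1, h2⟩, by simp [good, hcx, h3]⟩)
    refine ⟨D, hD, fun x hx => ?_⟩
    have := hg x hx
    simpa [good, hx.2] using this
  obtain ⟨D, hD, hg⟩ := fold_mix (fun v => !c v)
    (fun D => MinO G b k O D ∧ ∀ x, (b x < b' x ∧ c x = true) → x ∉ D) (by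
      obtain ⟨D, h1, h2⟩ := step1 u hu
      exact ⟨D, h1.1, h2⟩)
    (fun D E hD hE => ⟨mix_minO hA.not hO hk hD.1 hE.1,
      fun x hx => mix_not_mem (hD.2 x hx) (hE.2 x hx)⟩)
    (fun x => b x < b' x ∧ c x = false) (by
      rintro x ⟨hx, hcx⟩
      obtain ⟨D, h1, h2⟩ := step1 x hx
      exact ⟨D, ⟨h1.1, h2⟩, by simp [good, hcx, h1.2]⟩)
  refine ⟨D, hD.1, fun x hx => ?_⟩
  cases hcx : c x
  · have := hg x ⟨hx, hcx⟩
    simpa [good, hcx] using this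
  · exact hD.2 x ⟨hx, hcx⟩

/-- Augmentation. -/
theorem aug (hA : Att G H c) {b b' : V → ℤ} {k : ℤ}
    (hk : ∀ D, Cov G D → k ≤ ∑ v ∈ D, b v) (hk' : ∀ D, Cov G D → k + 1 ≤ ∑ v ∈ D, b' v)
    (hne : ∃ u, b u < b' u) :
    (∃ x, b x < b' x ∧ ∀ D, Cov G D → k + 1 ≤ ∑ v ∈ D, b v + ind x D) ∨
    (∃ x y, x ≠ y ∧ b x < b' x ∧ b y < b' y ∧
      ∀ D, Cov G D → k + 1 ≤ ∑ v ∈ D, b v + ind x D + ind y D) := by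
  obtain ⟨u, hu⟩ := hne
  by_contra hcon
  push Not at hcon
  obtain ⟨h1, h2⟩ := hcon
  obtain ⟨O, hO, hPO, hpO, D, hD, hav⟩ := aug_core hA hk hu
    (fun x hx => by
      obtain ⟨D, hD, h⟩ := h1 x hx
      exact ⟨D, hD, by omega⟩)
    (fun x y hxy hx hy => by
      obtain ⟨D, hD, h⟩ := h2 x y hxy hx hy
      exact ⟨D, hD, by omega⟩)
  have h3 := hk' D hD.1
  have h4 : ∑ v ∈ D, b' v ≤ ∑ v ∈ D, b v := by
    apply Finset.sum_le_sum
    intro v hv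
    by_contra h
    exact hav v (by omega) hv
  have := hD.2.2
  omega

theorem exch_aux (hA : Att G H c) {b b' : V → ℤ} {k : ℤ}
    (hk : ∀ D, Cov G D → k ≤ ∑ v ∈ D, b v)
    (hk' : ∀ D, Cov G D → k ≤ ∑ v ∈ D, b' v) (hsum : ∑ v, b' v ≤ ∑ v, b v)
    {u : V} (hu : b u < b' u) (hcu : c u = true) :
    (∃ x, b x < b' x ∧ ∀ D, Cov G D → k + 1 ≤ ∑ v ∈ D, b v + ind x D) ∨
    (∃ x y, x ≠ y ∧ b x < b' x ∧ b y < b' y ∧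
      ∀ D, Cov G D → k + 1 ≤ ∑ v ∈ D, b v + ind x D + ind y D) ∨
    (∃ v, b' v < b v ∧ ∀ D, Cov G D → k + ind v D ≤ ∑ v ∈ D, b v + ind u D) := by
  by_contra hcon
  push Not at hcon
  obtain ⟨h1, h2, h3⟩ := hcon
  obtain ⟨O, hO, hPO, hpO, D0, hD0, hav⟩ := aug_core hA hk hu
    (fun x hx => by
      obtain ⟨D, hD, h⟩ := h1 x hx
      exact ⟨D, hD, by omega⟩)
    (fun x y hxy hx hy => by
      obtain ⟨D, hD, h⟩ := h2 x y hxy hx hy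
      exact ⟨D, hD, by omega⟩)
  have heq : ∀ v ∈ D0, b v = b' v := by
    intro v hv
    have hle : ∀ v ∈ D0, b' v ≤ b v := fun v hv => by
      by_contra h
      exact hav v (by omega) hv
    by_contra hne
    have : ∑ v ∈ D0, b' v < ∑ v ∈ D0, b v :=
      Finset.sum_lt_sum hle ⟨v, hv, lt_of_le_of_ne (hle v hv) (Ne.symm hne)⟩
    have := hk' D0 hD0.1
    have := hD0.2.2
    omega
  have hN : ∀ v, b' v < b v → ∃ D, MinO G b k O D ∧ v ∈ D ∧ u ∉ D := by
    intro v hv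
    obtain ⟨D, hD, h⟩ := h3 v hv
    have h4 := hk D hD
    have h5 := ind_nonneg u D
    have h6 := ind_le_one v D
    have hvD : v ∈ D := mem_of_ind (by omega)
    have huD : u ∉ D := not_mem_of_ind (by omega)
    have hsumw : ∀ E : Finset V, ∑ x ∈ E, (b x - if x = v then 1 else 0)
        = ∑ x ∈ E, b x - ind v E := by
      intro E
      rw [Finset.sum_sub_distrib, Finset.sum_ite_eq', ind]
    obtain ⟨D', h7, h8, h9, _, h10⟩ := swap_lemma hA hO
      (fun x => b x - if x = v then 1 else 0) (by
      intro x hxO y hyO _ _ hs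
      have hx1 := heq x (hD0.2.1 hxO)
      have hxv : x ≠ v := by rintro rfl; omega
      simp only [tb_eq hx1] at hs
      rw [if_neg hxv]
      have := tb_le b b' y
      split_ifs with hyv
      · subst hyv
        rw [tb_gt hv] at hs
        omega
      · omega) D hD
    rw [hsumw, hsumw] at h9
    have h11 := hk D' h7
    have h12 := ind_le_one v D'
    exact ⟨D', ⟨h7, h8, by omega⟩, mem_of_ind (by omega), h10 u (hPO u hu) huD⟩
  have hLmix : ∀ c', Att G H c' → ∀ D E, (MinO G b k O D ∧ u ∉ D) → (MinO G b k O E ∧ u ∉ E) →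
      (MinO G b k O (mix c' D E) ∧ u ∉ mix c' D E) := fun c' hA' D E hD hE =>
    ⟨mix_minO hA' hO hk hD.1 hE.1, mix_not_mem hD.2 hE.2⟩
  have hLne : ∃ D, MinO G b k O D ∧ u ∉ D := ⟨D0, hD0, hav u hu⟩
  have main : ∀ c', Att G H c' → ∃ D, (MinO G b k O D ∧ u ∉ D) ∧
      (∀ v, b v ≠ b' v → c' v = true → v ∉ D) ∧ (∀ v, b' v < b v → c' v = false → v ∈ D) := by
    intro c' hA'
    obtain ⟨D, hD, hg⟩ := fold_mix c' (fun D => MinO G b k O D ∧ u ∉ D) hLne (hLmix c' hA')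
      (fun v => (b v ≠ b' v ∧ c' v = true) ∨ (b' v < b v ∧ c' v = false)) (by
        rintro v (⟨hv, hc⟩ | ⟨hv, hc⟩)
        · rcases lt_or_gt_of_ne hv with hv | hv
          · obtain ⟨D, h4, h5, h6⟩ := hpO u v hu hv
            exact ⟨D, ⟨h4, h5⟩, by simp [good, hc, h6]⟩
          · refine ⟨D0, ⟨hD0, hav u hu⟩, ?_⟩
            have : v ∉ D0 := fun h => by have := heq v h; omega
            simp [good, hc, this]
        · obtain ⟨D, h4, h5, h6⟩ := hN v hv
          exact ⟨D, ⟨h4, h6⟩, by simp [good, hc, h5]⟩)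
    refine ⟨D, hD, fun v hv hc => ?_, fun v hv hc => ?_⟩
    · simpa [good, hc] using hg v (Or.inl ⟨hv, hc⟩)
    · simpa [good, hc] using hg v (Or.inr ⟨hv, hc⟩)
  obtain ⟨E1, ⟨hE1, huE1⟩, hE1a, hE1b⟩ := main _ hA.not
  obtain ⟨E2, ⟨hE2, huE2⟩, hE2a, hE2b⟩ := main c hA
  simp only [Bool.not_eq_true', Bool.not_eq_false'] at hE1a hE1b
  have hpt : ∑ v, ((if v ∈ E1 then b' v - b v else 0) + (if v ∈ E2 then b' v - b v else 0)
      + if v = u then 1 else 0) ≤ ∑ v, (b' v - b v) := by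
    apply Finset.sum_le_sum
    intro v _
    cases hc : c v
    · have hvu : v ≠ u := by rintro rfl; simp [hcu] at hc
      have e1 : (if v ∈ E1 then b' v - b v else 0) = 0 := by
        split_ifs with h
        · by_contra h'
          exact hE1a v (by omega) hc h
        · rfl
      rw [e1, if_neg hvu]
      split_ifs with h
      · simp
      · by_contra h'
        exact h (hE2b v (by omega) hc)
    · have e2 : (if v ∈ E2 then b' v - b v else 0) = 0 := by
        split_ifs with h
        · by_contra h'
          exact hE2a v (by omega) hc h
        · rfl
      rw [e2]
      by_cases hvu : v = u
      · subst hvu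
        simp only [huE1, if_false, if_true]
        omega
      · rw [if_neg hvu]
        split_ifs with h
        · simp
        · by_contra h'
          exact h (hE1b v (by omega) hc)
  rw [Finset.sum_add_distrib, Finset.sum_add_distrib, ← sum_eq_ite (fun v => b' v - b v),
    ← sum_eq_ite (fun v => b' v - b v), Finset.sum_ite_eq', if_pos (Finset.mem_univ u),
    Finset.sum_sub_distrib, Finset.sum_sub_distrib, Finset.sum_sub_distrib] at hpt
  have := hk' E1 hE1.1
  have := hk' E2 hE2.1
  have := hE1.2.2
  have := hE2.2.2
  omega

/-- Exchange property. -/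
theorem exch (hA : Att G H c) {b b' : V → ℤ} {k : ℤ}
    (hk : ∀ D, Cov G D → k ≤ ∑ v ∈ D, b v)
    (hk' : ∀ D, Cov G D → k ≤ ∑ v ∈ D, b' v) (hsum : ∑ v, b' v ≤ ∑ v, b v)
    {u : V} (hu : b u < b' u) :
    (∃ x, b x < b' x ∧ ∀ D, Cov G D → k + 1 ≤ ∑ v ∈ D, b v + ind x D) ∨
    (∃ x y, x ≠ y ∧ b x < b' x ∧ b y < b' y ∧
      ∀ D, Cov G D → k + 1 ≤ ∑ v ∈ D, b v + ind x D + ind y D) ∨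
    (∃ v, b' v < b v ∧ ∀ D, Cov G D → k + ind v D ≤ ∑ v ∈ D, b v + ind u D) := by
  cases hcu : c u
  · exact exch_aux hA.not hk hk' hsum hu (by simp [hcu])
  · exact exch_aux hA hk hk' hsum hu hcu

/-- Minimal covers. -/
def MinG (G : SimpleGraph V) (b : V → ℤ) (k : ℤ) (D : Finset V) : Prop :=
  Cov G D ∧ ∑ v ∈ D, b v ≤ k

theorem coverage_aux (hA : Att G H c) {b : V → ℤ} {k : ℤ}
    (hk : ∀ D, Cov G D → k ≤ ∑ v ∈ D, b v) {u w : V} (huw : u ≠ w) (hnadj : ¬ G.Adj u w)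
    (hu : ∃ D, MinG G b k D ∧ u ∉ D) (hw : ∃ D, MinG G b k D ∧ w ∉ D)
    (hno : ∀ D, MinG G b k D → u ∈ D ∨ w ∈ D) (hcu : c u = true) :
    ∃ x y, G.Adj x y ∧ (∀ D, MinG G b k D → x ∉ D ∨ y ∉ D) ∧
      (∀ D, MinG G b k D → u ∈ D ∨ y ∈ D) ∧ (∀ D, MinG G b k D → w ∈ D ∨ x ∈ D) := by
  obtain ⟨O, hO⟩ := exists_choice hA (fun v => 2 * b v + if v = u ∨ v = w then 1 else 0)
  have hout : ∀ x, (x = u ∨ x = w) → x ∉ O := by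
    intro x hx hxO
    obtain ⟨y, hyH, hyO, hxy, hs⟩ := hO.rep x hxO
    have hy : ¬ (y = u ∨ y = w) := by
      rintro (rfl | rfl) <;> rcases hx with rfl | rfl
      · exact G.irrefl hxy
      · exact hnadj hxy.symm
      · exact hnadj hxy
      · exact G.irrefl hxy
    simp only [hx, hy, if_true, if_false] at hs
    have : ∃ D, MinG G b k D ∧ x ∉ D := by
      rcases hx with rfl | rfl
      · exact hu
      · exact hw
    obtain ⟨D, hD, hxD⟩ := this
    have hyD : y ∈ D := (hD.1 x y hxy).resolve_left hxD
    have h3 := hk _ (twin_swap hA (hO.out x hxO) hyH hxy hD.1 hxD)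
    rw [sum_twin_swap b hxD hyD] at h3
    have := hD.2
    omega
  have huO : u ∉ O := hout u (Or.inl rfl)
  have hwO : w ∉ O := hout w (Or.inr rfl)
  have tr : ∀ D, MinG G b k D → ∃ D', MinO G b k O D' ∧ (∀ z ∈ H, z ∈ D' ↔ z ∈ D) ∧
      ∀ z, z ∉ O → z ∉ D → z ∉ D' := by
    intro D hD
    obtain ⟨D', h1, h2, h3, h4, h5⟩ := swap_lemma hA hO b (by
      intro x _ y _ _ _ hs
      split_ifs at hs <;> omega) D hD.1
    exact ⟨D', ⟨h1, h2, h3.trans hD.2⟩, h4, h5⟩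
  have toG : ∀ D, MinO G b k O D → MinG G b k D := fun D h => ⟨h.1, h.2.2⟩
  have hLmix : ∀ c', Att G H c' → ∀ D E, (MinO G b k O D ∧ u ∉ D) → (MinO G b k O E ∧ u ∉ E) →
      (MinO G b k O (mix c' D E) ∧ u ∉ mix c' D E) := fun c' hA' D E hD hE =>
    ⟨mix_minO hA' hO hk hD.1 hE.1, mix_not_mem hD.2 hE.2⟩
  have hLne : ∃ D, MinO G b k O D ∧ u ∉ D := by
    obtain ⟨D, hD, huD⟩ := hu
    obtain ⟨D', h1, _, h2⟩ := tr D hD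
    exact ⟨D', h1, h2 u huO huD⟩
  obtain ⟨E, hE, hwE⟩ : ∃ D, MinO G b k O D ∧ w ∉ D := by
    obtain ⟨D, hD, hwD⟩ := hw
    obtain ⟨D', h1, _, h2⟩ := tr D hD
    exact ⟨D', h1, h2 w hwO hwD⟩
  have hcw : c w = false := by
    by_contra hcw
    rw [Bool.not_eq_false] at hcw
    obtain ⟨D, hD, huD⟩ := hLne
    have h1 := mix_minO hA hO hk hD hE
    rcases hno _ (toG _ h1) with h | h
    · rw [mem_mix, if_pos hcu] at h
      exact huD h.1
    · rw [mem_mix, if_pos hcw] at h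
      exact hwE h.2
  obtain ⟨D, ⟨hD, huD⟩, hg⟩ := fold_mix (fun v => !c v) (fun D => MinO G b k O D ∧ u ∉ D) hLne
    (hLmix _ hA.not)
    (fun v => ∃ D, (MinO G b k O D ∧ u ∉ D) ∧ good (fun v => !c v) v D) (fun v h => h)
  have hmaxA : ∀ v D', MinO G b k O D' → u ∉ D' → c v = true → v ∈ D' → v ∈ D := by
    intro v D' h1 h2 h3 h4
    simpa [good, h3] using hg v ⟨D', ⟨h1, h2⟩, by simp [good, h3, h4]⟩
  have hminB : ∀ v D', MinO G b k O D' → u ∉ D' → c v = false → v ∉ D' → v ∉ D := by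
    intro v D' h1 h2 h3 h4
    simpa [good, h3] using hg v ⟨D', ⟨h1, h2⟩, by simp [good, h3, h4]⟩
  have hwD : w ∈ D := (hno D (toG D hD)).resolve_left huD
  obtain ⟨x, hxH, hwx, hxD⟩ : ∃ x, x ∈ H ∧ G.Adj w x ∧ x ∉ D := by
    by_contra hcon
    push Not at hcon
    let Z : Finset V := Finset.univ.filter fun z => G.Adj w z ∧ z ∉ D
    have mZ : ∀ z, z ∈ Z ↔ G.Adj w z ∧ z ∉ D := fun z => by simp [Z]
    have hZH : ∀ z ∈ Z, z ∉ H := fun z hz h =>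
      ((mZ z).1 hz).2 (hcon z h ((mZ z).1 hz).1)
    -- first cover
    have hc1 : Cov G (D.erase w ∪ Z) := by
      intro p q hpq
      simp only [Finset.mem_union, Finset.mem_erase, mZ]
      by_cases hp : p = w
      · subst hp
        by_cases hq : q ∈ D
        · exact Or.inr (Or.inl ⟨hpq.ne', hq⟩)
        · exact Or.inr (Or.inr ⟨hpq, hq⟩)
      by_cases hq : q = w
      · subst hq
        by_cases hp' : p ∈ D
        · exact Or.inl (Or.inl ⟨hpq.ne, hp'⟩)
        · exact Or.inl (Or.inr ⟨hpq.symm, hp'⟩)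
      rcases hD.1 p q hpq with h | h
      · exact Or.inl (Or.inl ⟨hp, h⟩)
      · exact Or.inr (Or.inl ⟨hq, h⟩)
    have hdisj : Disjoint (D.erase w) Z := by
      rw [Finset.disjoint_left]
      intro z hz hz'
      exact ((mZ z).1 hz').2 (Finset.mem_of_mem_erase hz)
    have hs1 : ∑ v ∈ D.erase w ∪ Z, b v = ∑ v ∈ D, b v - b w + ∑ v ∈ Z, b v := by
      rw [Finset.sum_union hdisj, ← Finset.add_sum_erase D b hwD]
      ring
    have hlt : b w < ∑ v ∈ Z, b v := by
      by_contra hle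
      rcases hno _ ⟨hc1, by rw [hs1]; have := hD.2.2; omega⟩ with h | h
      · simp only [Finset.mem_union, Finset.mem_erase, mZ] at h
        rcases h with h | h
        · exact huD h.2
        · exact hnadj h.1.symm
      · simp only [Finset.mem_union, Finset.mem_erase, mZ] at h
        rcases h with h | h
        · exact h.1 rfl
        · exact G.irrefl h.1
    have hZE : Z ⊆ E := fun z hz => (hE.1 w z ((mZ z).1 hz).1).resolve_left hwE
    have hc2 : Cov G (insert w (E \ Z)) := by
      have key : ∀ z t, z ∈ Z → G.Adj z t → t ≠ w → t ∈ E \ Z := by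
        intro z t hz hzt htw
        have hz' := (mZ z).1 hz
        have htD : t ∈ D := (hD.1 z t hzt).resolve_left hz'.2
        rw [Finset.mem_sdiff]
        refine ⟨?_, fun h => ((mZ t).1 h).2 htD⟩
        have hwt : G.Adj w t := by
          by_cases hwH : w ∈ H
          · by_cases htH : t ∈ H
            · exact absurd (hA.uniq z (hZH z hz) t htH w hwH hzt hz'.1.symm) htw
            · exact (hA.twin z t w (hZH z hz) htH hzt htw.symm hz'.1.symm).symm
          · exact hA.twin z w t (hZH z hz) hwH hz'.1.symm htw hzt
        exact (hE.1 w t hwt).resolve_left hwE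
      intro p q hpq
      simp only [Finset.mem_insert]
      by_cases hpw : p = w
      · exact Or.inl (Or.inl hpw)
      by_cases hqw : q = w
      · exact Or.inr (Or.inl hqw)
      by_cases hp : p ∈ Z
      · exact Or.inr (Or.inr (key p q hp hpq hqw))
      by_cases hq : q ∈ Z
      · exact Or.inl (Or.inr (key q p hq hpq.symm hpw))
      rcases hE.1 p q hpq with h | h
      · exact Or.inl (Or.inr (Finset.mem_sdiff.2 ⟨h, hp⟩))
      · exact Or.inr (Or.inr (Finset.mem_sdiff.2 ⟨h, hq⟩))
    have h1 := hk _ hc2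
    rw [Finset.sum_insert (by simp [hwE])] at h1
    have h2 := Finset.sum_sdiff (f := b) hZE
    have := hE.2.2
    omega
  have hcx : c x = true := by
    have := hA.color x hxH w hwx.symm
    rw [hcw] at this
    simpa using this
  have hxE : x ∈ E := (hE.1 w x hwx).resolve_left hwE
  have hxO : x ∉ O := fun h => hO.out x h hxH
  obtain ⟨y, hyH, hxy, htight⟩ : ∃ y, y ∈ H ∧ G.Adj x y ∧
      ∀ D, MinO G b k O D → x ∉ D ∨ y ∉ D := by
    by_contra hcon
    push Not at hcon
    obtain ⟨F, ⟨hF, hxF⟩, hgF⟩ := fold_mix c (fun D => MinO G b k O D ∧ x ∈ D) ⟨E, hE, hxE⟩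
      (fun D E hD hE => ⟨mix_minO hA hO hk hD.1 hE.1, mix_mem hD.2 hE.2⟩)
      (fun y => y ∈ H ∧ G.Adj x y) (by
        rintro y ⟨hy, hxy⟩
        obtain ⟨D, h1, h2, h3⟩ := hcon y hy hxy
        have hcy : c y = false := by
          have := hA.color x hxH y hxy
          rw [hcx] at this
          simpa using this.symm
        exact ⟨D, ⟨h1, h2⟩, by simp [good, hcy, h3]⟩)
    have hFH : ∀ y, y ∈ H → G.Adj x y → y ∈ F := by
      intro y hy hxy
      have hcy : c y = false := by
        have := hA.color x hxH y hxy
        rw [hcx] at this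
        simpa using this.symm
      simpa [good, hcy] using hgF y ⟨hy, hxy⟩
    let Z : Finset V := Finset.univ.filter fun z => G.Adj x z ∧ z ∉ F
    have mZ : ∀ z, z ∈ Z ↔ G.Adj x z ∧ z ∉ F := fun z => by simp [Z]
    have hZH : ∀ z ∈ Z, z ∉ H := fun z hz h =>
      ((mZ z).1 hz).2 (hFH z h ((mZ z).1 hz).1)
    have hc1 : Cov G (F.erase x ∪ Z) := by
      intro p q hpq
      simp only [Finset.mem_union, Finset.mem_erase, mZ]
      by_cases hp : p = x
      · subst hp
        by_cases hq : q ∈ F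
        · exact Or.inr (Or.inl ⟨hpq.ne', hq⟩)
        · exact Or.inr (Or.inr ⟨hpq, hq⟩)
      by_cases hq : q = x
      · subst hq
        by_cases hp' : p ∈ F
        · exact Or.inl (Or.inl ⟨hpq.ne, hp'⟩)
        · exact Or.inl (Or.inr ⟨hpq.symm, hp'⟩)
      rcases hF.1 p q hpq with h | h
      · exact Or.inl (Or.inl ⟨hp, h⟩)
      · exact Or.inr (Or.inl ⟨hq, h⟩)
    have hdisj : Disjoint (F.erase x) Z := by
      rw [Finset.disjoint_left]
      intro z hz hz'
      exact ((mZ z).1 hz').2 (Finset.mem_of_mem_erase hz)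
    have hs1 : ∑ v ∈ F.erase x ∪ Z, b v = ∑ v ∈ F, b v - b x + ∑ v ∈ Z, b v := by
      rw [Finset.sum_union hdisj, ← Finset.add_sum_erase F b hxF]
      ring
    have hge : b x ≤ ∑ v ∈ Z, b v := by
      have := hk _ hc1
      have := hF.2.2
      omega
    have hZD : Z ⊆ D := fun z hz => (hD.1 x z ((mZ z).1 hz).1).resolve_left hxD
    have hc2 : Cov G (insert x (D \ Z)) := by
      have key : ∀ z t, z ∈ Z → G.Adj z t → t ≠ x → t ∈ D \ Z := by
        intro z t hz hzt htx
        have hz' := (mZ z).1 hz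
        have htF : t ∈ F := (hF.1 z t hzt).resolve_left hz'.2
        rw [Finset.mem_sdiff]
        refine ⟨?_, fun h => ((mZ t).1 h).2 htF⟩
        have hxt : G.Adj x t := by
          by_cases htH : t ∈ H
          · exact absurd (hA.uniq z (hZH z hz) t htH x hxH hzt hz'.1.symm) htx
          · exact (hA.twin z t x (hZH z hz) htH hzt htx.symm hz'.1.symm).symm
        exact (hD.1 x t hxt).resolve_left hxD
      intro p q hpq
      simp only [Finset.mem_insert]
      by_cases hpw : p = x
      · exact Or.inl (Or.inl hpw)
      by_cases hqw : q = x
      · exact Or.inr (Or.inl hqw)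
      by_cases hp : p ∈ Z
      · exact Or.inr (Or.inr (key p q hp hpq hqw))
      by_cases hq : q ∈ Z
      · exact Or.inl (Or.inr (key q p hq hpq.symm hpw))
      rcases hD.1 p q hpq with h | h
      · exact Or.inl (Or.inr (Finset.mem_sdiff.2 ⟨h, hp⟩))
      · exact Or.inr (Or.inr (Finset.mem_sdiff.2 ⟨h, hq⟩))
    have h2 := Finset.sum_sdiff (f := b) hZD
    have hmin : MinO G b k O (insert x (D \ Z)) := by
      refine ⟨hc2, ?_, ?_⟩
      · intro z hz
        refine Finset.mem_insert_of_mem (Finset.mem_sdiff.2 ⟨hD.2.1 hz, fun h => ?_⟩)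
        exact ((mZ z).1 h).2 (hF.2.1 hz)
      · rw [Finset.sum_insert (by simp [hxD])]
        have := hD.2.2
        omega
    refine hxD (hmaxA x _ hmin ?_ hcx (Finset.mem_insert_self _ _))
    simp only [Finset.mem_insert, Finset.mem_sdiff, not_or]
    refine ⟨?_, fun h => huD h.1⟩
    rintro rfl
    exact hnadj hwx.symm
  have hcy : c y = false := by
    have := hA.color x hxH y hxy
    rw [hcx] at this
    simpa using this.symm
  have hyO : y ∉ O := fun h => hO.out y h hyH
  refine ⟨x, y, hxy, ?_, ?_, ?_⟩
  · intro D' hD'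
    obtain ⟨D2, h1, h2, _⟩ := tr D' hD'
    rw [← h2 x hxH, ← h2 y hyH]
    exact htight D2 h1
  · intro D' hD'
    by_contra hcon
    rw [not_or] at hcon
    obtain ⟨D2, h1, _, h2⟩ := tr D' hD'
    have := hminB y D2 h1 (h2 u huO hcon.1) hcy (h2 y hyO hcon.2)
    rcases hD.1 x y hxy with h | h
    · exact hxD h
    · exact this h
  · intro D' hD'
    exact hD'.1 w x hwx

theorem coverage (hA : Att G H c) {b : V → ℤ} {k : ℤ}
    (hk : ∀ D, Cov G D → k ≤ ∑ v ∈ D, b v) {u w : V} (huw : u ≠ w) (hnadj : ¬ G.Adj u w)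
    (hu : ∃ D, MinG G b k D ∧ u ∉ D) (hw : ∃ D, MinG G b k D ∧ w ∉ D)
    (hno : ∀ D, MinG G b k D → u ∈ D ∨ w ∈ D) :
    ∃ x y, G.Adj x y ∧ (∀ D, MinG G b k D → x ∉ D ∨ y ∉ D) ∧
      (∀ D, MinG G b k D → u ∈ D ∨ y ∈ D) ∧ (∀ D, MinG G b k D → w ∈ D ∨ x ∈ D) := by
  cases hcu : c u
  · exact coverage_aux hA.not hk huw hnadj hu hw hno (by simp [hcu])
  · exact coverage_aux hA hk huw hnadj hu hw hno hcu

end RegAux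

namespace RegAux
open EdgeIdealReg
open scoped Classical

variable {V : Type}

theorem no_two_K2 {Q : SimpleGraph V} (hQ : ChordalOn Qᶜ Set.univ) {s t x y : V}
    (hst : Q.Adj s t) (hxy : Q.Adj x y) (h1 : s ≠ x) (h2 : s ≠ y) (h3 : t ≠ x) (h4 : t ≠ y)
    (h5 : ¬ Q.Adj s x) (h6 : ¬ Q.Adj s y) (h7 : ¬ Q.Adj t x) (h8 : ¬ Q.Adj t y) : False := by
  have hts := hst.ne
  have hyx := hxy.ne
  have h5' : ¬ Q.Adj x s := fun h => h5 h.symm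
  have h6' : ¬ Q.Adj y s := fun h => h6 h.symm
  have h7' : ¬ Q.Adj x t := fun h => h7 h.symm
  have h8' : ¬ Q.Adj y t := fun h => h8 h.symm
  have key : ∀ f : Fin 4 → V, f = ![s, x, t, y] → Function.Injective f ∧
      ∀ i j : Fin 4, Qᶜ.Adj (f i) (f j) ↔ (j = i + 1 ∨ i = j + 1) := by
    rintro f rfl
    constructor
    · intro i j h
      fin_cases i <;> fin_cases j <;> simp_all
    · intro i j
      fin_cases i <;> fin_cases j <;>
        simp [SimpleGraph.compl_adj, hst, hxy, hst.symm, hxy.symm, h1, h2, h3, h4, h5, h6, h7, h8,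
          h5', h6', h7', h8', h1.symm, h2.symm, h3.symm, h4.symm]
  obtain ⟨ha, hb⟩ := key _ rfl
  exact hQ 4 le_rfl ⟨![s, x, t, y], ha, fun _ => Set.mem_univ _, hb⟩

/-- Enlarged graph. -/
def enl (M : Finset V → Prop) (Q : SimpleGraph V) : SimpleGraph V where
  Adj p q := p ≠ q ∧ (Q.Adj p q ∨ ∃ x y, Q.Adj x y ∧ (∀ D, M D → x ∉ D ∨ y ∉ D) ∧
    (∀ D, M D → p ∈ D ∨ y ∈ D) ∧ (∀ D, M D → q ∈ D ∨ x ∈ D))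
  symm := ⟨by
    rintro p q ⟨hne, h | ⟨x, y, h1, h2, h3, h4⟩⟩
    · exact ⟨hne.symm, Or.inl h.symm⟩
    · exact ⟨hne.symm, Or.inr ⟨y, x, h1.symm, fun D hD => (h2 D hD).symm, h4, h3⟩⟩⟩
  loopless := ⟨fun p h => h.1 rfl⟩

theorem enl_noedge {M : Finset V → Prop} {G Q : SimpleGraph V} (hM : ∀ D, M D → Cov G D)
    (hQG : Q ≤ G) (hQ : ChordalOn Qᶜ Set.univ) {x y : V} (hxy : Q.Adj x y)
    {s t : V}
    (hsP : ¬ ∀ D, M D → s ∈ D ∨ y ∈ D) (hsR : ¬ ∀ D, M D → s ∈ D ∨ x ∈ D)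
    (htP : ¬ ∀ D, M D → t ∈ D ∨ y ∈ D) (htR : ¬ ∀ D, M D → t ∈ D ∨ x ∈ D) :
    ¬ (enl M Q).Adj s t := by
  have nb : ∀ p q, Q.Adj p q → ∀ D, M D → p ∈ D ∨ q ∈ D := fun p q h D hD => hM D hD p q (hQG h)
  rintro ⟨hne, hst | ⟨a, d, had, htad, hs, ht⟩⟩
  · refine no_two_K2 hQ hst hxy ?_ ?_ ?_ ?_ (fun h => hsR (nb _ _ h)) (fun h => hsP (nb _ _ h))
      (fun h => htR (nb _ _ h)) (fun h => htP (nb _ _ h))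
    · rintro rfl; exact hsP (nb _ _ hxy)
    · rintro rfl; exact hsR (nb _ _ hxy.symm)
    · rintro rfl; exact htP (nb _ _ hxy)
    · rintro rfl; exact htR (nb _ _ hxy.symm)
  · have ha : ∀ z, Q.Adj a z → ∀ D, M D → s ∈ D ∨ z ∈ D := by
      intro z hz D hD
      have h1 := hs D hD
      have h2 := htad D hD
      have h3 := nb a z hz D hD
      tauto
    have hd : ∀ z, Q.Adj d z → ∀ D, M D → t ∈ D ∨ z ∈ D := by
      intro z hz D hD
      have h1 := ht D hD
      have h2 := htad D hD
      have h3 := nb d z hz D hD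
      tauto
    refine no_two_K2 hQ had hxy ?_ ?_ ?_ ?_ (fun h => hsR (ha _ h)) (fun h => hsP (ha _ h))
      (fun h => htR (hd _ h)) (fun h => htP (hd _ h))
    · rintro rfl; exact htR ht
    · rintro rfl; exact htP ht
    · rintro rfl; exact hsR hs
    · rintro rfl; exact hsP hs

theorem enl_chordal {M : Finset V → Prop} {G Q : SimpleGraph V} (hM : ∀ D, M D → Cov G D)
    (hQG : Q ≤ G) (hQ : ChordalOn Qᶜ Set.univ) {U : Set V}
    (hU : ∀ p ∈ U, ∃ D, M D ∧ p ∉ D) : ChordalOn (enl M Q)ᶜ U := by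
  rintro n hn ⟨f, finj, fU, hf⟩
  haveI : NeZero n := ⟨by omega⟩
  have hadj : ∀ i j, i ≠ j → ((enl M Q).Adj (f i) (f j) ↔ ¬ (j = i + 1 ∨ i = j + 1)) := by
    intro i j hij
    rw [← hf i j, SimpleGraph.compl_adj]
    have : f i ≠ f j := fun h => hij (finj h)
    tauto
  by_cases hall : ∀ i j, (enl M Q).Adj (f i) (f j) → Q.Adj (f i) (f j)
  · refine hQ n hn ⟨f, finj, fun _ => Set.mem_univ _, ?_⟩
    intro i j
    rw [← hf i j, SimpleGraph.compl_adj, SimpleGraph.compl_adj]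
    have : Q.Adj (f i) (f j) → (enl M Q).Adj (f i) (f j) := fun h => ⟨h.ne, Or.inl h⟩
    have := hall i j
    tauto
  push Not at hall
  obtain ⟨i, j, hij, hnij⟩ := hall
  obtain ⟨hne, h | ⟨x, y, hxy, htight, hiP, hjR⟩⟩ := hij
  · exact hnij h
  let P : ZMod n → Prop := fun a => ∀ D, M D → f a ∈ D ∨ y ∈ D
  let R : ZMod n → Prop := fun a => ∀ D, M D → f a ∈ D ∨ x ∈ D
  have disj : ∀ a, P a → R a → False := by
    intro a ha hb
    obtain ⟨D, hD, haD⟩ := hU (f a) (fU a)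
    have := ha D hD
    have := hb D hD
    have := htight D hD
    tauto
  have hPR : ∀ a b, P a → R b → ¬ (b = a + 1 ∨ a = b + 1) := by
    intro a b ha hb
    have hab : a ≠ b := by rintro rfl; exact disj a ha hb
    rw [← hadj a b hab]
    exact ⟨fun h => hab (finj h), Or.inr ⟨x, y, hxy, htight, ha, hb⟩⟩
  have hPi : P i := hiP
  have hRj : R j := hjR
  have hPj : ¬ P j := fun h => disj j h hRj
  have hnoedge : ∀ a b, ¬ P a → ¬ R a → ¬ P b → ¬ R b → a ≠ b → (b = a + 1 ∨ a = b + 1) := by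
    intro a b h1 h2 h3 h4 hab
    by_contra hcon
    exact enl_noedge hM hQG hQ hxy h1 h2 h3 h4 ((hadj a b hab).2 hcon)
  set k := (j - i).val with hk
  have hkn : k < n := ZMod.val_lt _
  have hjk : j = i + (k : ZMod n) := by
    rw [hk, ZMod.natCast_zmod_val]; ring
  have hex1 : ∃ m : ℕ, ¬ P (i + (m : ZMod n)) := ⟨k, by rwa [← hjk]⟩
  have hjk' : j = i - ((n - k : ℕ) : ZMod n) := by
    rw [Nat.cast_sub hkn.le, hjk]; simp
  have hex2 : ∃ m : ℕ, ¬ P (i - (m : ZMod n)) := ⟨n - k, by rwa [← hjk']⟩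
  set s := Nat.find hex1 with hs
  set t := Nat.find hex2 with ht
  have hs1 : ¬ P (i + (s : ZMod n)) := Nat.find_spec hex1
  have ht1 : ¬ P (i - (t : ZMod n)) := Nat.find_spec hex2
  have hs0 : s ≠ 0 := by
    intro h
    rw [h] at hs1
    simp only [Nat.cast_zero, add_zero] at hs1
    exact hs1 hPi
  have ht0 : t ≠ 0 := by
    intro h
    rw [h] at ht1
    simp only [Nat.cast_zero, sub_zero] at ht1
    exact ht1 hPi
  have hs2 : ¬ R (i + (s : ZMod n)) := by
    have hp : P (i + ((s - 1 : ℕ) : ZMod n)) := by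
      by_contra h
      have := Nat.find_min' hex1 h
      omega
    intro hr
    apply hPR _ _ hp hr
    left
    rw [add_assoc, ← Nat.cast_add_one]
    congr 2
    omega
  have ht2 : ¬ R (i - (t : ZMod n)) := by
    have hp : P (i - ((t - 1 : ℕ) : ZMod n)) := by
      by_contra h
      have := Nat.find_min' hex2 h
      omega
    intro hr
    apply hPR _ _ hp hr
    right
    have : (t : ZMod n) = ((t - 1 : ℕ) : ZMod n) + 1 := by
      rw [← Nat.cast_add_one]; congr 1; omega
    rw [this]; ring
  have hsk : s < k := by
    have h1 : s ≤ k := Nat.find_min' hex1 (by rwa [← hjk])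
    refine lt_of_le_of_ne h1 fun h => ?_
    rw [h, ← hjk] at hs2
    exact hs2 hRj
  have htk : t < n - k := by
    have h1 : t ≤ n - k := Nat.find_min' hex2 (by rwa [← hjk'])
    refine lt_of_le_of_ne h1 fun h => ?_
    rw [h, ← hjk'] at ht2
    exact ht2 hRj
  have cast0 : ∀ m : ℕ, 0 < m → m < n → (m : ZMod n) ≠ 0 := by
    intro m h1 h2 h
    rw [ZMod.natCast_eq_zero_iff] at h
    exact absurd (Nat.le_of_dvd h1 h) (by omega)
  have hne' : i + (s : ZMod n) ≠ i - (t : ZMod n) := by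
    intro h
    apply cast0 (s + t) (by omega) (by omega)
    push_cast
    linear_combination h
  rcases hnoedge _ _ hs1 hs2 ht1 ht2 hne' with h | h
  · apply cast0 (s + t + 1) (by omega) (by omega)
    push_cast
    linear_combination -h
  · apply cast0 (s + t - 1) (by omega) (by omega)
    rw [Nat.cast_sub (by omega)]
    push_cast
    linear_combination h

/-- An optimal co-chordal cover. -/
theorem exists_cochord [Fintype V] (G : SimpleGraph V) :
    ∃ Q : Fin (cochordNumber G) → SimpleGraph V, (∀ i, Q i ≤ G ∧ ChordalOn (Q i)ᶜ Set.univ) ∧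
      ∀ u v, G.Adj u v → ∃ i, (Q i).Adj u v := by
  have hne : { n | ∃ H : Fin n → SimpleGraph V,
    (∀ i, H i ≤ G ∧ Chordal (H i)ᶜ) ∧ ∀ e ∈ G.edgeSet, ∃ i, e ∈ (H i).edgeSet }.Nonempty := by
    let e := Fintype.equivFin G.edgeSet
    refine ⟨Fintype.card G.edgeSet, fun i => SimpleGraph.fromEdgeSet {(e.symm i : Sym2 V)}, ?_, ?_⟩
    · intro i
      have hmem := (e.symm i).2
      beta_reduce
      generalize ((e.symm i : G.edgeSet) : Sym2 V) = E at hmem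
      induction E using Sym2.ind with
      | _ p q =>
      rw [SimpleGraph.mem_edgeSet] at hmem
      have hadj : ∀ a d, (SimpleGraph.fromEdgeSet {s(p, q)}).Adj a d →
          (a = p ∧ d = q) ∨ (a = q ∧ d = p) := by
        intro a d h
        rw [SimpleGraph.fromEdgeSet_adj] at h
        simpa using h.1
      constructor
      · intro a d h
        rcases hadj a d h with ⟨rfl, rfl⟩ | ⟨rfl, rfl⟩
        · exact hmem
        · exact hmem.symm
      · rintro n hn ⟨f, finj, hf⟩
        haveI : NeZero n := ⟨by omega⟩
        have cast0 : ∀ m : ℕ, 0 < m → m < n → (m : ZMod n) ≠ 0 := by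
          intro m h1 h2 h
          rw [ZMod.natCast_eq_zero_iff] at h
          exact absurd (Nat.le_of_dvd h1 h) (by omega)
        have c1 := cast0 1 (by omega) (by omega)
        have c2 := cast0 2 (by omega) (by omega)
        have c3 := cast0 3 (by omega) (by omega)
        push_cast at c1 c2 c3
        have key : ∀ i : ZMod n, (SimpleGraph.fromEdgeSet {s(p, q)}).Adj (f i) (f (i + 2)) := by
          intro i
          have h1 : f i ≠ f (i + 2) := fun h => c2 (by linear_combination -(finj h))
          by_contra h2
          rcases (hf i (i + 2)).1 ⟨h1, h2⟩ with h | h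
          · exact c1 (by linear_combination h)
          · exact c3 (by linear_combination -h)
        have k0 := hadj _ _ (key 0)
        have k1 := hadj _ _ (key 1)
        have d1 : f 0 ≠ f 1 := fun h => c1 (finj h).symm
        have d2 : f 0 ≠ f (1 + 2) := fun h => c3 (by linear_combination -(finj h))
        rcases k0 with h | h <;> rcases k1 with h' | h'
        · exact d1 (h.1.trans h'.1.symm)
        · exact d2 (h.1.trans h'.2.symm)
        · exact d2 (h.1.trans h'.2.symm)
        · exact d1 (h.1.trans h'.1.symm)
    · intro E hE
      refine ⟨e ⟨E, hE⟩, ?_⟩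
      rw [SimpleGraph.edgeSet_fromEdgeSet]
      simp only [Equiv.symm_apply_apply]
      exact ⟨rfl, G.not_isDiag_of_mem_edgeSet hE⟩
  obtain ⟨Q, h1, h2⟩ := Nat.sInf_mem hne
  refine ⟨Q, fun i => ⟨(h1 i).1, ?_⟩, fun u v huv => h2 s(u, v) huv⟩
  rintro n hn ⟨f, finj, _, hf⟩
  exact (h1 i).2 n hn ⟨f, finj, hf⟩

end RegAux

namespace RegAux
open EdgeIdealReg
open scoped Classical

variable {V K : Type} [Field K] [Fintype V] {G : SimpleGraph V} {H : Set V} {c : V → Bool}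

/-- Sort key for the degree-lexicographic order. -/
def dkey (b : V →₀ ℕ) : ℕ ×ₗ Lex (Fin (Fintype.card V) → ℕ) :=
  toLex (b.degree, toLex (fun i => b ((Fintype.equivFin V).symm i)))

theorem dkey_inj : Function.Injective (dkey (V := V)) := by
  intro a b h
  have h1 : (fun i => a ((Fintype.equivFin V).symm i)) =
      (fun i => b ((Fintype.equivFin V).symm i)) :=
    congrArg (fun z : ℕ ×ₗ Lex (Fin (Fintype.card V) → ℕ) => ofLex (ofLex z).2) h
  ext v
  simpa using congrFun h1 (Fintype.equivFin V v)

theorem dkey_lt {a b : V →₀ ℕ} : dkey a < dkey b ↔ a.degree < b.degree ∨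
    (a.degree = b.degree ∧ ∃ u, (∀ v, Fintype.equivFin V v < Fintype.equivFin V u → a v = b v) ∧
      a u < b u) := by
  unfold dkey
  rw [Prod.Lex.lt_iff]
  refine or_congr Iff.rfl (and_congr Iff.rfl ?_)
  constructor
  · rintro ⟨i, h1, h2⟩
    refine ⟨(Fintype.equivFin V).symm i, fun v hv => ?_, h2⟩
    rw [Equiv.apply_symm_apply] at hv
    have := h1 _ hv
    simpa using this
  · rintro ⟨u, h1, h2⟩
    refine ⟨Fintype.equivFin V u, fun j hj => ?_, ?_⟩
    · exact h1 _ (by rw [Equiv.apply_symm_apply]; exact hj)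
    · show a ((Fintype.equivFin V).symm _) < b ((Fintype.equivFin V).symm _)
      rw [Equiv.symm_apply_apply]; exact h2

theorem mem_US {b : V →₀ ℕ} {k : ℕ} :
    b ∈ US G k ↔ ∀ D, Cov G D → (k : ℤ) ≤ ∑ v ∈ D, (b v : ℤ) := by
  unfold US
  rw [Set.mem_ofPred_eq]
  refine forall_congr' fun D => imp_congr_right fun _ => ?_
  rw [← Nat.cast_sum]
  exact Nat.cast_le.symm

theorem sum_add_single (b : V →₀ ℕ) (x : V) (D : Finset V) :
    ∑ v ∈ D, ((b + Finsupp.single x 1 : V →₀ ℕ) v : ℤ) = ∑ v ∈ D, (b v : ℤ) + ind x D := by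
  have : ∀ v, ((b + Finsupp.single x 1 : V →₀ ℕ) v : ℤ) = (b v : ℤ) + if v = x then 1 else 0 := by
    intro v
    rw [Finsupp.add_apply, Finsupp.single_apply]
    push_cast
    simp only [eq_comm]
  simp only [this]
  rw [Finset.sum_add_distrib, Finset.sum_ite_eq', ind]

theorem add_single_le {b a : V →₀ ℕ} (h : b ≤ a) {x : V} (hx : b x < a x) :
    b + Finsupp.single x 1 ≤ a := by
  intro v
  rw [Finsupp.add_apply, Finsupp.single_apply]
  split_ifs with hv
  · subst hv; exact hx
  · exact h v

theorem exists_lt_of_le_ne {b a : V →₀ ℕ} (h : b ≤ a) (hne : b ≠ a) : ∃ u, b u < a u := by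
  by_contra hcon
  push Not at hcon
  exact hne (le_antisymm h hcon)

theorem degree_add_single (b : V →₀ ℕ) (x : V) :
    (b + Finsupp.single x 1).degree = b.degree + 1 := by
  simp

/-- The symbolic power is generated in degrees at most `2 k`. -/
theorem US_gen (hA : Att G H c) (k : ℕ) : ∀ a ∈ US G k, ∃ b ≤ a, b ∈ US G k ∧ b.degree ≤ 2 * k := by
  induction k with
  | zero =>
    intro a _
    exact ⟨0, bot_le, by rw [mem_US]; intro D _; simp, by simp⟩
  | succ k ih =>
    intro a ha
    rw [mem_US] at ha
    obtain ⟨b, hba, hb, hdeg⟩ := ih a (by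
      rw [mem_US]; intro D hD; have := ha D hD; push_cast at this; omega)
    by_cases hb1 : b ∈ US G (k + 1)
    · exact ⟨b, hba, hb1, by omega⟩
    have hne : b ≠ a := by
      rintro rfl; exact hb1 (by rw [mem_US]; exact ha)
    obtain ⟨u, hu⟩ := exists_lt_of_le_ne hba hne
    rw [mem_US] at hb
    rcases aug hA (b := fun v => (b v : ℤ)) (b' := fun v => (a v : ℤ)) (k := k) hb
      (fun D hD => by have := ha D hD; push_cast at this; exact this)
      ⟨u, by exact_mod_cast hu⟩ with ⟨x, hx, h⟩ | ⟨x, y, hxy, hx, hy, h⟩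
    · refine ⟨b + Finsupp.single x 1, add_single_le hba (by exact_mod_cast hx), ?_, ?_⟩
      · rw [mem_US]
        intro D hD
        rw [sum_add_single]
        push_cast
        exact h D hD
      · rw [degree_add_single]; omega
    · refine ⟨b + Finsupp.single x 1 + Finsupp.single y 1,
        add_single_le (add_single_le hba (by exact_mod_cast hx)) ?_, ?_, ?_⟩
      · rw [Finsupp.add_apply, Finsupp.single_eq_of_ne (Ne.symm hxy)]
        exact_mod_cast hy
      · rw [mem_US]
        intro D hD
        rw [sum_add_single, sum_add_single]
        push_cast
        exact h D hD
      · rw [degree_add_single, degree_add_single]; omega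

theorem regU_colon (hA : Att G H c) {m : ℕ} (Q : Fin m → SimpleGraph V)
    (hQ : ∀ i, Q i ≤ G ∧ ChordalOn (Q i)ᶜ Set.univ)
    (hcov : ∀ u v, G.Adj u v → ∃ i, (Q i).Adj u v) (k : ℕ) (T : Set (V →₀ ℕ)) (b : V →₀ ℕ)
    (hb : b ∈ US G k) (hdeg : b.degree = 2 * k)
    (hT : ∀ a, a ∈ T ↔ a ∈ US G k ∧ a.degree ≤ 2 * k ∧ dkey b < dkey a)
    (C : Set (V →₀ ℕ)) (hCup : IsUpperSet C)
    (hC : ∀ e, e ∈ C ↔ b + e ∈ US G (k + 1) ∨ ∃ a ∈ T, a ≤ b + e) :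
    RegU K (m + 1) C := by
  by_cases h0 : (0 : V →₀ ℕ) ∈ C
  · have : C = Set.univ := Set.eq_univ_of_forall fun e => hCup bot_le h0
    rw [this]
    exact regU_univ _
  let W : Finset V := Finset.univ.filter fun u => Finsupp.single u 1 ∈ C
  have mW : ∀ u, u ∈ W ↔ Finsupp.single u 1 ∈ C := fun u => by simp [W]
  let M := MinG G (fun v => (b v : ℤ)) (k : ℤ)
  have hM : ∀ D, M D → Cov G D := fun D h => h.1
  have hbz := mem_US.1 hb
  have hb1 : b ∉ US G (k + 1) := fun h => h0 ((hC 0).2 (Or.inl (by simpa using h)))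
  have hWav : ∀ p, p ∉ W → ∃ D, M D ∧ p ∉ D := by
    intro p hp
    by_contra hcon
    push Not at hcon
    apply hp
    rw [mW, hC]
    left
    rw [mem_US]
    intro D hD
    rw [sum_add_single]
    push_cast
    have h1 := hbz D hD
    by_cases h2 : ∑ v ∈ D, (b v : ℤ) ≤ k
    · rw [ind_of_mem (hcon D ⟨hD, h2⟩)]; omega
    · have := ind_nonneg p D; omega
  have hmain : C = LU (W : Set V) (List.ofFn fun i => enl M (Q i)) := by
    have hpair : ∀ e : V →₀ ℕ, ∀ x y, x ≠ y → 1 ≤ e x → 1 ≤ e y →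
        (∀ D, Cov G D → (k : ℤ) + 1 ≤ ∑ v ∈ D, (b v : ℤ) + ind x D + ind y D) →
        e ∈ LU (W : Set V) (List.ofFn fun i => enl M (Q i)) := by
      intro e x y hxy hx hy h
      by_cases hxW : x ∈ W
      · exact Or.inl ⟨x, hxW, hx⟩
      by_cases hyW : y ∈ W
      · exact Or.inl ⟨y, hyW, hy⟩
      by_cases hadj : G.Adj x y
      · obtain ⟨i, hi⟩ := hcov x y hadj
        exact Or.inr ⟨enl M (Q i), List.mem_ofFn.2 ⟨i, rfl⟩, x, y, ⟨hxy, Or.inl hi⟩, hx, hy⟩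
      obtain ⟨p, q, hpq, h1, h2, h3⟩ := coverage hA hbz hxy hadj (hWav x hxW) (hWav y hyW) (by
        intro D hD
        by_contra hcon
        rw [not_or] at hcon
        have h4 := h D hD.1
        rw [ind_of_not_mem hcon.1, ind_of_not_mem hcon.2] at h4
        have h5 : ∑ v ∈ D, (b v : ℤ) ≤ k := hD.2
        omega)
      obtain ⟨i, hi⟩ := hcov p q hpq
      exact Or.inr ⟨enl M (Q i), List.mem_ofFn.2 ⟨i, rfl⟩, x, y,
        ⟨hxy, Or.inr ⟨p, q, hi, h1, h2, h3⟩⟩, hx, hy⟩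
    have hone : ∀ e : V →₀ ℕ, ∀ x, 1 ≤ e x →
        (∀ D, Cov G D → (k : ℤ) + 1 ≤ ∑ v ∈ D, (b v : ℤ) + ind x D) →
        e ∈ LU (W : Set V) (List.ofFn fun i => enl M (Q i)) := by
      intro e x hx h
      refine Or.inl ⟨x, (mW x).2 ((hC _).2 (Or.inl ?_)), hx⟩
      rw [mem_US]
      intro D hD
      rw [sum_add_single]
      push_cast
      exact h D hD
    ext e
    constructor
    · intro he
      rcases (hC e).1 he with h | ⟨a, haT, hae⟩
      · have hne : b ≠ b + e := fun h' => hb1 (by rw [h']; exact h)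
        obtain ⟨u, hu⟩ := exists_lt_of_le_ne le_self_add hne
        have hlt : ∀ x, ((b x : ℕ) : ℤ) < (((b + e : V →₀ ℕ) x : ℕ) : ℤ) → 1 ≤ e x := by
          intro x hx
          rw [Finsupp.add_apply] at hx
          push_cast at hx
          omega
        rcases aug hA (b := fun v => (b v : ℤ)) (b' := fun v => (((b + e : V →₀ ℕ) v : ℕ) : ℤ))
          (k := k) hbz
          (fun D hD => by have := mem_US.1 h D hD; push_cast at this ⊢; exact this)
          ⟨u, by exact_mod_cast hu⟩ with ⟨x, hx, h⟩ | ⟨x, y, hxy, hx, hy, h⟩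
        · exact hone e x (hlt x hx) h
        · exact hpair e x y hxy (hlt x hx) (hlt y hy) h
      · obtain ⟨ha, had, hlt⟩ := (hT a).1 haT
        have hlt' : ∀ x, ((b x : ℕ) : ℤ) < ((a x : ℕ) : ℤ) → 1 ≤ e x := by
          intro x hx
          have := hae x
          rw [Finsupp.add_apply] at this
          omega
        rcases dkey_lt.1 hlt with h | ⟨hdeq, u, hu1, hu2⟩
        · omega
        rcases exch hA (b := fun v => (b v : ℤ)) (b' := fun v => (a v : ℤ)) (k := k) hbz
          (mem_US.1 ha) (by
            rw [Finsupp.degree_eq_sum, Finsupp.degree_eq_sum] at hdeq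
            rw [← Nat.cast_sum, ← Nat.cast_sum, hdeq]) (u := u) (by exact_mod_cast hu2)
          with ⟨x, hx, h⟩ | ⟨x, y, hxy, hx, hy, h⟩ | ⟨v, hv, h⟩
        · exact hone e x (hlt' x hx) h
        · exact hpair e x y hxy (hlt' x hx) (hlt' y hy) h
        · have hv' : a v < b v := by exact_mod_cast hv
          have huv : v ≠ u := by rintro rfl; omega
          obtain ⟨a', ha'⟩ : ∃ a', b + Finsupp.single u 1 = a' + Finsupp.single v 1 := by
            refine ⟨b + Finsupp.single u 1 - Finsupp.single v 1, ?_⟩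
            rw [tsub_add_cancel_of_le]
            rw [Finsupp.single_le_iff, Finsupp.add_apply]
            omega
          have hval : ∀ z, b z + (if z = u then 1 else 0) = a' z + (if z = v then 1 else 0) := by
            intro z
            have := DFunLike.congr_fun ha' z
            rw [Finsupp.add_apply, Finsupp.add_apply, Finsupp.single_apply,
              Finsupp.single_apply] at this
            simpa only [eq_comm] using this
          have hda' : a'.degree = b.degree := by
            have := congrArg Finsupp.degree ha'
            rw [degree_add_single, degree_add_single] at this
            omega
          refine Or.inl ⟨u, (mW u).2 ((hC _).2 (Or.inr ⟨a', (hT a').2 ⟨?_, by omega, ?_⟩, ?_⟩)),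
            hlt' u (by exact_mod_cast hu2)⟩
          · rw [mem_US]
            intro D hD
            have h1 := h D hD
            have h2 := sum_add_single b u D
            rw [ha', sum_add_single] at h2
            omega
          · rw [dkey_lt]
            refine Or.inr ⟨hda'.symm, u, ?_, ?_⟩
            · intro z hz
              have h1 := hval z
              have hzu : z ≠ u := by rintro rfl; exact lt_irrefl _ hz
              have hzv : z ≠ v := by
                rintro rfl
                have := hu1 z hz
                omega
              simpa [hzu, hzv] using h1
            · have h1 := hval u
              rw [if_pos rfl, if_neg huv.symm] at h1
              omega
          · rw [ha']; exact le_self_add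
    · rintro (⟨w, hw, hew⟩ | ⟨Q', hQ', u, v, huv, hu, hv⟩)
      · exact hCup (Finsupp.single_le_iff.2 hew) ((mW w).1 hw)
      · obtain ⟨i, rfl⟩ := List.mem_ofFn.1 hQ'
        rw [hC]
        left
        refine upper_US G (k + 1) (a := b + Finsupp.single u 1 + Finsupp.single v 1) ?_ ?_
        · refine add_single_le (add_single_le le_self_add ?_) ?_
          · rw [Finsupp.add_apply]; omega
          · rw [Finsupp.add_apply, Finsupp.add_apply, Finsupp.single_eq_of_ne huv.ne.symm]
            omega
        · rw [mem_US]
          intro D hD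
          rw [sum_add_single, sum_add_single]
          push_cast
          have h1 := hbz D hD
          have i1 := ind_nonneg u D
          have i2 := ind_nonneg v D
          by_cases h2 : ∑ z ∈ D, (b z : ℤ) ≤ k
          · have hMD : M D := ⟨hD, h2⟩
            have : u ∈ D ∨ v ∈ D := by
              rcases huv.2 with h | ⟨x, y, _, h3, h4, h5⟩
              · exact hD u v ((hQ i).1 h)
              · have := h3 D hMD
                have := h4 D hMD
                have := h5 D hMD
                tauto
            rcases this with h | h
            · rw [ind_of_mem h]; omega
            · rw [ind_of_mem h]; omega
          · omega
  rw [hmain]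
  have := woodroofe (K := K) (List.ofFn fun i => enl M (Q i)) W (by
    intro Q' hQ'
    obtain ⟨i, rfl⟩ := List.mem_ofFn.1 hQ'
    exact enl_chordal hM (hQ i).1 (hQ i).2 (fun p hp => hWav p (by simpa using hp)))
  rwa [List.length_ofFn] at this

theorem regU_low (C : Set (V →₀ ℕ)) (hCup : IsUpperSet C) (h : ∀ v, Finsupp.single v 1 ∈ C) :
    RegU K 1 C := by
  by_cases h0 : (0 : V →₀ ℕ) ∈ C
  · have : C = Set.univ := Set.eq_univ_of_forall fun e => hCup bot_le h0
    rw [this]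
    exact regU_univ _
  have : C = LU ((Finset.univ : Finset V) : Set V) [] := by
    ext e
    constructor
    · intro he
      have hne : (0 : V →₀ ℕ) ≠ e := by rintro rfl; exact h0 he
      obtain ⟨u, hu⟩ := exists_lt_of_le_ne bot_le hne
      exact Or.inl ⟨u, by simp, hu⟩
    · rintro (⟨w, _, hw⟩ | ⟨_, hh, _⟩)
      · exact hCup (Finsupp.single_le_iff.2 hw) (h w)
      · simp at hh
  rw [this]
  exact regU_vars _

theorem regU_succ (hA : Att G H c) {m : ℕ} (Q : Fin m → SimpleGraph V)
    (hQ : ∀ i, Q i ≤ G ∧ ChordalOn (Q i)ᶜ Set.univ)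
    (hcov : ∀ u v, G.Adj u v → ∃ i, (Q i).Adj u v) (k d : ℕ) (hd : 2 * k + m + 1 ≤ d)
    (hprev : RegU K d (US G k)) : RegU K d (US G (k + 1)) := by
  have hfin : {b : V →₀ ℕ | b ∈ US G k ∧ b.degree ≤ 2 * k}.Finite :=
    (Finsupp.finite_of_degree_le (σ := V) (2 * k)).subset fun b hb => hb.2
  let B : Finset (V →₀ ℕ) := hfin.toFinset
  have mB : ∀ b, b ∈ B ↔ b ∈ US G k ∧ b.degree ≤ 2 * k := fun b => by simp [B]
  have hUS : US G (k + 1) ⊆ US G k := fun a ha D hD => (Nat.le_succ k).trans (ha D hD)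
  let A : Finset (V →₀ ℕ) → Set (V →₀ ℕ) := fun T => {e | e ∈ US G (k + 1) ∨ ∃ a ∈ T, a ≤ e}
  have hAup : ∀ T, IsUpperSet (A T) := by
    rintro T x y hxy (h | ⟨a, ha, hax⟩)
    · exact Or.inl (upper_US G (k + 1) hxy h)
    · exact Or.inr ⟨a, ha, hax.trans hxy⟩
  have main : ∀ n : ℕ, ∀ T ⊆ B, (∀ a ∈ T, ∀ b ∈ B, dkey a < dkey b → b ∈ T) →
      (B \ T).card = n → RegU K d (A T) := by
    intro n
    induction n with
    | zero =>
      intro T hTB _ hcard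
      have hTB' : T = B := by
        refine Finset.Subset.antisymm hTB ?_
        rw [← Finset.sdiff_eq_empty_iff_subset]
        exact Finset.card_eq_zero.1 hcard
      have : A T = US G k := by
        ext e
        constructor
        · rintro (h | ⟨a, ha, hae⟩)
          · exact hUS h
          · exact upper_US G k hae ((mB a).1 (hTB ha)).1
        · intro he
          obtain ⟨a, h1, h2, h3⟩ := US_gen hA k e he
          exact Or.inr ⟨a, by rw [hTB', mB]; exact ⟨h2, h3⟩, h1⟩
      rw [this]
      exact hprev
    | succ n ih =>
      intro T hTB hTup hcard
      obtain ⟨b, hbm, hmax⟩ := Finset.exists_max_image (B \ T) dkey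
        (Finset.card_pos.1 (by omega))
      obtain ⟨hbB, hbT⟩ := Finset.mem_sdiff.1 hbm
      obtain ⟨hbU, hbd⟩ := (mB b).1 hbB
      have hT : ∀ a, a ∈ T ↔ a ∈ US G k ∧ a.degree ≤ 2 * k ∧ dkey b < dkey a := by
        intro a
        constructor
        · intro ha
          have haB := (mB a).1 (hTB ha)
          refine ⟨haB.1, haB.2, ?_⟩
          rcases lt_trichotomy (dkey b) (dkey a) with h | h | h
          · exact h
          · exact absurd (dkey_inj h ▸ ha) hbT
          · exact absurd (hTup a ha b hbB h) hbT
        · rintro ⟨h1, h2, h3⟩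
          by_contra haT
          exact absurd h3 (hmax a (Finset.mem_sdiff.2 ⟨(mB a).2 ⟨h1, h2⟩, haT⟩)).not_gt
      have hins : A T ∪ Set.Ici b = A (insert b T) := by
        ext e
        simp only [A, Set.mem_union, Set.mem_ofPred_eq, Set.mem_Ici, Finset.mem_insert,
          exists_eq_or_imp]
        rw [or_assoc, or_comm (b := b ≤ e)]
      have hB' : RegU K d (A T ∪ Set.Ici b) := by
        rw [hins]
        apply ih
        · exact Finset.insert_subset hbB hTB
        · intro a ha x hx hlt
          rcases Finset.mem_insert.1 ha with rfl | ha
          · exact Finset.mem_insert_of_mem ((hT x).2 ⟨((mB x).1 hx).1, ((mB x).1 hx).2, hlt⟩)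
          · exact Finset.mem_insert_of_mem (hTup a ha x hx hlt)
        · have h1 : B \ insert b T = (B \ T).erase b := by
            ext x; simp only [Finset.mem_sdiff, Finset.mem_insert, Finset.mem_erase]; tauto
          rw [h1, Finset.card_erase_of_mem hbm, hcard]
          rfl
      rcases lt_or_eq_of_le hbd with hlt | heq
      · refine regU_step (hAup T) b (dA := 1) ?_ (by omega) hB' (by omega)
        refine regU_low _ (upper_colon (hAup T) b) fun v => ?_
        refine Or.inr ⟨b + Finsupp.single v 1, (hT _).2 ⟨upper_US G k le_self_add hbU, ?_, ?_⟩, le_rfl⟩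
        · rw [degree_add_single]; omega
        · rw [dkey_lt, degree_add_single]; left; omega
      · refine regU_step (hAup T) b (dA := m + 1) ?_ (by omega) hB' (by omega)
        exact regU_colon hA Q hQ hcov k (T : Set (V →₀ ℕ)) b hbU heq
          (fun a => by rw [Finset.mem_coe]; exact hT a) _ (upper_colon (hAup T) b)
          (fun e => Iff.rfl)
  have := main _ ∅ (by simp) (by simp) rfl
  have h2 : A ∅ = US G (k + 1) := by
    ext e; simp [A]
  rwa [h2] at this

theorem regU_US (hA : Att G H c) (k : ℕ) :
    RegU K (2 * k + cochordNumber G + 1) (US G (k + 1)) := by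
  obtain ⟨Q, hQ, hcov⟩ := exists_cochord G
  induction k with
  | zero =>
    refine regU_succ hA Q hQ hcov 0 _ (by omega) ?_
    have : US G 0 = Set.univ := Set.eq_univ_of_forall fun e D _ => Nat.zero_le _
    rw [this]
    exact regU_univ _
  | succ k ih =>
    exact regU_succ hA Q hQ hcov (k + 1) _ (by omega) (ih.mono (by omega))

end RegAux

open EdgeIdealReg in
/-- If `H` is bipartite and `G = H_T` is obtained by attaching unions of complete graphs at
the vertices of `T ⊆ V(H)`, then `reg(S/I(G)^{(r)}) ≤ 2r + cochord(G) - 2` for all `r ≥ 1`. -/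
theorem reg_symbolic_le_cochord_bound {V K : Type} [Field K] [Fintype V] [DecidableEq V]
    (G : SimpleGraph V) (Hset T : Set V) (hbip : (G.induce Hset).Colorable 2)
    (hatt : Nonempty (CliqueAttachment G Hset T)) (r : ℕ) (hr : 1 ≤ r) :
    regQuot (symbolicPower (edgeIdeal K G) r) ≤
      ((2 * (r : ℤ) + (cochordNumber G : ℤ) - 2 : ℤ) : WithBot ℤ) := by
  obtain ⟨A⟩ := hatt
  obtain ⟨c, hA⟩ := RegAux.att_of A hbip
  obtain ⟨k, rfl⟩ : ∃ k, r = k + 1 := ⟨r - 1, by omega⟩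
  rw [RegAux.symb_eq]
  have h := RegAux.regQuot_le (RegAux.upper_US G (k + 1)) (RegAux.regU_US (K := K) hA k)
  have e : (2 * ((k + 1 : ℕ) : ℤ) + (cochordNumber G : ℤ) - 2 : ℤ)
      = ((2 * k + cochordNumber G : ℕ) : ℤ) := by
    push_cast; ring
  rw [e]
  exact h
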